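/- There exists D > 0 depending only on C₀ such that the following holds: if ε, β > 0 satisfy β ≤ D²ε⁴ and u is an admissible solution of (★) whose initial datum satisfies the data bounds with constant C₀, then there is a constant C depending only on C₀ such that for every t > 0: ε‖∂_x u(t,·)‖_{L²(ℝ)} ≤ C, (βε)^{1/2}‖∂_x² u(t,·)‖_{L²(ℝ)} ≤ C, εβ^{1/2}‖∂_x² u(t,·)‖_{L²(ℝ)} ≤ C, β‖∂_x² u(t,·)‖_{L²(ℝ)} ≤ C, βε‖∂_x³ u(t,·)‖_{L²(ℝ)} ≤ C, β^{3/2}‖∂_x³ u(t,·)‖_{L²(ℝ)} ≤ C, and β²‖∂_x⁴ u(t,·)‖_{L²(ℝ)} ≤ C. -/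

import Mathlib

open MeasureTheory Real Filter Set

noncomputable section

/-- `mixedD u j k t x`: `j` time derivatives of the `k`-th spatial derivative of `u` at `(t,x)`. -/
def mixedD (u : ℝ → ℝ → ℝ) (j k : ℕ) (t x : ℝ) : ℝ :=
  iteratedDeriv j (fun s => iteratedDeriv k (fun y => u s y) x) t

/-- Squared `L²` norm in the space variable. -/
def sqL2 (f : ℝ → ℝ) : ℝ := ∫ x : ℝ, (f x) ^ 2

/-- `L²` norm in the space variable. -/
def nL2 (f : ℝ → ℝ) : ℝ := Real.sqrt (∫ x : ℝ, (f x) ^ 2)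

/-- `L⁴` norm in the space variable. -/
def nL4 (f : ℝ → ℝ) : ℝ := (∫ x : ℝ, (f x) ^ 4) ^ ((1 : ℝ) / 4)

/-- Admissible solution of the Rosenau–KdV–RLW approximation (★). -/
structure IsAdmissibleKdVRLW (ε β : ℝ) (u : ℝ → ℝ → ℝ) : Prop where
  smooth : ContDiff ℝ (⊤ : ℕ∞) (fun p : ℝ × ℝ => u p.1 p.2)
  pde : ∀ t > (0 : ℝ), ∀ x : ℝ,
    mixedD u 1 0 t x + deriv (fun y => (u t y) ^ 2) x
      + β * mixedD u 0 3 t x - β * mixedD u 1 2 t x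
      + β ^ 2 * mixedD u 1 4 t x = ε * mixedD u 0 2 t x
  sq_int : ∀ T > (0 : ℝ), ∀ j k : ℕ, j + k ≤ 5 → ∀ t ∈ Set.Icc (0 : ℝ) T,
    MeasureTheory.Integrable (fun x : ℝ => (mixedD u j k t x) ^ 2)
  decay : ∀ T > (0 : ℝ), ∀ j k : ℕ, j + k ≤ 5 → ∀ δ > (0 : ℝ), ∃ M : ℝ,
    ∀ x : ℝ, M ≤ |x| → ∀ t ∈ Set.Icc (0 : ℝ) T, |mixedD u j k t x| ≤ δ

/-- Admissible solution of the Rosenau–RLW approximation (★★). -/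
structure IsAdmissibleRLW (ε β : ℝ) (u : ℝ → ℝ → ℝ) : Prop where
  smooth : ContDiff ℝ (⊤ : ℕ∞) (fun p : ℝ × ℝ => u p.1 p.2)
  pde : ∀ t > (0 : ℝ), ∀ x : ℝ,
    mixedD u 1 0 t x + deriv (fun y => (u t y) ^ 2) x
      - β * mixedD u 1 2 t x + β ^ 2 * mixedD u 1 4 t x = ε * mixedD u 0 2 t x
  sq_int : ∀ T > (0 : ℝ), ∀ j k : ℕ, j + k ≤ 5 → ∀ t ∈ Set.Icc (0 : ℝ) T,
    MeasureTheory.Integrable (fun x : ℝ => (mixedD u j k t x) ^ 2)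
  decay : ∀ T > (0 : ℝ), ∀ j k : ℕ, j + k ≤ 5 → ∀ δ > (0 : ℝ), ∃ M : ℝ,
    ∀ x : ℝ, M ≤ |x| → ∀ t ∈ Set.Icc (0 : ℝ) T, |mixedD u j k t x| ≤ δ

/-- Data bounds with constant `C0` for the (★) approximation. -/
def DataBoundsKdVRLW (ε β C0 : ℝ) (f : ℝ → ℝ) : Prop :=
  (∫ x : ℝ, (f x) ^ 2) + (∫ x : ℝ, (f x) ^ 4)
      + (β + ε ^ 2) * (∫ x : ℝ, (deriv f x) ^ 2) ≤ C0 ∧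
  (β * ε + β * ε ^ 2 + β ^ 2) * (∫ x : ℝ, (iteratedDeriv 2 f x) ^ 2)
      + (β ^ 2 * ε ^ 2 + β ^ 3) * (∫ x : ℝ, (iteratedDeriv 3 f x) ^ 2) ≤ C0 ∧
  β ^ 4 * (∫ x : ℝ, (iteratedDeriv 4 f x) ^ 2) ≤ C0

/-- Data bounds with constant `C0` for the (★★) approximation. -/
def DataBoundsRLW (ε β C0 : ℝ) (f : ℝ → ℝ) : Prop :=
  (∫ x : ℝ, (f x) ^ 2) + (∫ x : ℝ, (f x) ^ 4)
    + β * ε ^ 2 * (∫ x : ℝ, (iteratedDeriv 2 f x) ^ 2) ≤ C0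

/-- `u ∈ L^∞((0,∞); L²(ℝ) ∩ L⁴(ℝ))`. -/
def BddL2L4 (u : ℝ → ℝ → ℝ) : Prop :=
  ∃ M : ℝ, ∀ t > (0 : ℝ), (∫ x : ℝ, (u t x) ^ 2) ≤ M ∧ (∫ x : ℝ, (u t x) ^ 4) ≤ M

/-- Entropy solution of `∂ₜ u + ∂ₓ (u²) = 0` with initial datum `u0`. -/
def IsEntropySolution (u : ℝ → ℝ → ℝ) (u0 : ℝ → ℝ) : Prop :=
  ∀ η : ℝ → ℝ, ContDiff ℝ 2 η → ConvexOn ℝ Set.univ η →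
    (∃ M : ℝ, ∀ v : ℝ, |deriv η v| ≤ M) →
    ∀ φ : ℝ → ℝ → ℝ, ContDiff ℝ (⊤ : ℕ∞) (fun p : ℝ × ℝ => φ p.1 p.2) →
      HasCompactSupport (fun p : ℝ × ℝ => φ p.1 p.2) →
      (∀ t x : ℝ, 0 ≤ φ t x) →
      0 ≤ (∫ t in Set.Ioi (0 : ℝ), ∫ x : ℝ,
            (η (u t x) * deriv (fun s => φ s x) t
              + (∫ ξ in (0 : ℝ)..(u t x), 2 * ξ * deriv η ξ) * deriv (fun y => φ t y) x))
          + ∫ x : ℝ, η (u0 x) * φ 0 x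

/-- Continuous, bounded and square-integrable functions. -/
structure Tame (f : ℝ → ℝ) : Prop where
  cont : Continuous f
  bdd : ∃ B, ∀ x, |f x| ≤ B
  sq : Integrable (fun x => f x ^ 2)

/-- `f` is integrable with integral `I`. -/
def HasInt (f : ℝ → ℝ) (I : ℝ) : Prop := Integrable f ∧ ∫ x, f x = I

namespace HasInt

variable {f g : ℝ → ℝ} {I J : ℝ}

lemma add (hf : HasInt f I) (hg : HasInt g J) : HasInt (fun x => f x + g x) (I + J) :=
  ⟨hf.1.add hg.1, by rw [integral_add hf.1 hg.1, hf.2, hg.2]⟩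

lemma smul (hf : HasInt f I) (c : ℝ) : HasInt (fun x => c * f x) (c * I) :=
  ⟨hf.1.const_mul c, by rw [integral_const_mul, hf.2]⟩

lemma le (hf : HasInt f I) (hg : HasInt g J) (h : ∀ x, f x ≤ g x) : I ≤ J := by
  rw [← hf.2, ← hg.2]
  exact integral_mono hf.1 hg.1 h

end HasInt

lemma MeasureTheory.Integrable.hasInt {f : ℝ → ℝ} (hf : Integrable f) : HasInt f (∫ x, f x) :=
  ⟨hf, rfl⟩

namespace Tame

variable {f g f' g' : ℝ → ℝ}

lemma integrable_mul (hf : Tame f) (hg : Tame g) : Integrable (fun x => f x * g x) := by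
  refine (hf.sq.add hg.sq).mono' (hf.cont.mul hg.cont).aestronglyMeasurable
    (Eventually.of_forall fun x => ?_)
  simp only [Pi.add_apply, norm_eq_abs, abs_mul]
  nlinarith [sq_nonneg (|f x| - |g x|), sq_abs (f x), sq_abs (g x), sq_nonneg (f x),
    sq_nonneg (g x)]

lemma mul (hf : Tame f) (hg : Tame g) : Tame (fun x => f x * g x) := by
  obtain ⟨B, hB⟩ := hf.bdd
  obtain ⟨B', hB'⟩ := hg.bdd
  refine ⟨hf.cont.mul hg.cont, ⟨B * B', fun x => ?_⟩, ?_⟩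
  · rw [abs_mul]
    exact mul_le_mul (hB x) (hB' x) (abs_nonneg _) ((abs_nonneg _).trans (hB x))
  · refine (hg.sq.const_mul (B ^ 2)).mono' ((hf.cont.mul hg.cont).pow 2).aestronglyMeasurable
      (Eventually.of_forall fun x => ?_)
    rw [norm_of_nonneg (by positivity), mul_pow]
    exact mul_le_mul_of_nonneg_right (sq_le_sq' (by linarith [neg_abs_le (f x), hB x])
      ((le_abs_self _).trans (hB x))) (sq_nonneg _)

lemma add (hf : Tame f) (hg : Tame g) : Tame (fun x => f x + g x) := by
  obtain ⟨B, hB⟩ := hf.bdd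
  obtain ⟨B', hB'⟩ := hg.bdd
  refine ⟨hf.cont.add hg.cont, ⟨B + B', fun x => (abs_add_le _ _).trans
    (add_le_add (hB x) (hB' x))⟩, ?_⟩
  refine ((hf.sq.add hg.sq).const_mul 2).mono' ((hf.cont.add hg.cont).pow 2).aestronglyMeasurable
    (Eventually.of_forall fun x => ?_)
  rw [norm_of_nonneg (by positivity)]
  simp only [Pi.add_apply]
  nlinarith [sq_nonneg (f x - g x)]

lemma smul (hf : Tame f) (c : ℝ) : Tame (fun x => c * f x) := by
  obtain ⟨B, hB⟩ := hf.bdd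
  refine ⟨continuous_const.mul hf.cont, ⟨|c| * B, fun x => ?_⟩, ?_⟩
  · rw [abs_mul]
    exact mul_le_mul_of_nonneg_left (hB x) (abs_nonneg _)
  · simpa only [mul_pow] using hf.sq.const_mul (c ^ 2)

lemma hasInt_sq (hf : Tame f) : HasInt (fun x => f x ^ 2) (∫ x, f x ^ 2) := hf.sq.hasInt

lemma hasInt_mul (hf : Tame f) (hg : Tame g) : HasInt (fun x => f x * g x) (∫ x, f x * g x) :=
  (hf.integrable_mul hg).hasInt

lemma hasInt_ibp (hf : Tame f) (hg : Tame g) (hf' : Tame f') (hg' : Tame g')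
    (df : ∀ x, HasDerivAt f (f' x) x) (dg : ∀ x, HasDerivAt g (g' x) x) :
    HasInt (fun x => f' x * g x + f x * g' x) 0 := by
  have h := (hf'.integrable_mul hg).add (hf.integrable_mul hg')
  exact ⟨h, integral_eq_zero_of_hasDerivAt_of_integrable (fun x => (df x).mul (dg x)) h
    (hf.integrable_mul hg)⟩

/-- One-dimensional Sobolev (Agmon) inequality. -/
lemma sq_le (hf : Tame f) (hf' : Tame f') (df : ∀ x, HasDerivAt f (f' x) x) {s : ℝ} (hs : 0 < s)
    (x : ℝ) : f x ^ 2 ≤ s * (∫ y, f y ^ 2) + s⁻¹ * ∫ y, f' y ^ 2 := by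
  have hd : ∀ y, HasDerivAt (fun z => f z ^ 2) (2 * (f y * f' y)) y := fun y => by
    refine ((df y).pow 2).congr_deriv ?_
    norm_num
    ring
  have hi : Integrable (fun y => 2 * (f y * f' y)) := (hf.integrable_mul hf').const_mul 2
  have h0 : Tendsto (fun z => f z ^ 2) atBot (nhds 0) :=
    tendsto_zero_of_hasDerivAt_of_integrableOn_Iic (a := x) (fun y _ => hd y)
      hi.integrableOn hf.sq.integrableOn
  have h1 : ∫ y in Iic x, 2 * (f y * f' y) = f x ^ 2 - 0 :=
    integral_Iic_of_hasDerivAt_of_tendsto' (fun y _ => hd y) hi.integrableOn h0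
  have hb : Integrable (fun y => s * f y ^ 2 + s⁻¹ * f' y ^ 2) :=
    (hf.sq.const_mul s).add (hf'.sq.const_mul s⁻¹)
  have hnn : ∀ y, 0 ≤ s * f y ^ 2 + s⁻¹ * f' y ^ 2 := fun y => by positivity
  have h2 : ∫ y in Iic x, 2 * (f y * f' y) ≤ ∫ y in Iic x, (s * f y ^ 2 + s⁻¹ * f' y ^ 2) := by
    refine setIntegral_mono hi.integrableOn hb.integrableOn fun y => ?_
    have : s * f y ^ 2 + s⁻¹ * f' y ^ 2 - 2 * (f y * f' y) = s * (f y - s⁻¹ * f' y) ^ 2 := by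
      field_simp
      ring
    have h3 : 0 ≤ s * (f y - s⁻¹ * f' y) ^ 2 := by positivity
    simp only
    linarith
  have h3 := setIntegral_le_integral (s := Iic x) hb (Eventually.of_forall hnn)
  rw [integral_add (hf.sq.const_mul s) (hf'.sq.const_mul s⁻¹), integral_const_mul,
    integral_const_mul] at h3
  linarith

end Tame

/-- A profile of the solution at a fixed time: `u k` and `v k` stand for `∂ₓᵏ u` and `∂ₜ∂ₓᵏ u`. -/
structure Slice (ε β : ℝ) (u v : ℕ → ℝ → ℝ) : Prop where
  tu : ∀ k ≤ 4, Tame (u k)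
  tv : ∀ k ≤ 4, Tame (v k)
  du : ∀ k x, HasDerivAt (u k) (u (k + 1) x) x
  dv : ∀ k x, HasDerivAt (v k) (v (k + 1) x) x
  pde : ∀ x, v 0 x + 2 * (u 0 x * u 1 x) + β * u 3 x - β * v 2 x + β ^ 2 * v 4 x = ε * u 2 x

namespace Slice

variable {ε β : ℝ} {u v : ℕ → ℝ → ℝ}

lemma ibp_uv (S : Slice ε β u v) (i j : ℕ) (hi : i ≤ 3) (hj : j ≤ 3) :
    HasInt (fun x => u (i + 1) x * v j x + u i x * v (j + 1) x) 0 :=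
  (S.tu i (by omega)).hasInt_ibp (S.tv j (by omega)) (S.tu _ (by omega)) (S.tv _ (by omega))
    (S.du i) (S.dv j)

lemma ibp_uu (S : Slice ε β u v) (i j : ℕ) (hi : i ≤ 3) (hj : j ≤ 3) :
    HasInt (fun x => u (i + 1) x * u j x + u i x * u (j + 1) x) 0 :=
  (S.tu i (by omega)).hasInt_ibp (S.tu j (by omega)) (S.tu _ (by omega)) (S.tu _ (by omega))
    (S.du i) (S.du j)

lemma ibp_vv (S : Slice ε β u v) (i j : ℕ) (hi : i ≤ 3) (hj : j ≤ 3) :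
    HasInt (fun x => v (i + 1) x * v j x + v i x * v (j + 1) x) 0 :=
  (S.tv i (by omega)).hasInt_ibp (S.tv j (by omega)) (S.tv _ (by omega)) (S.tv _ (by omega))
    (S.dv i) (S.dv j)

lemma tame_cube (S : Slice ε β u v) : Tame (fun x => u 0 x * (u 0 x * u 0 x)) :=
  (S.tu 0 (by omega)).mul ((S.tu 0 (by omega)).mul (S.tu 0 (by omega)))

lemma tame_cube_deriv (S : Slice ε β u v) :
    Tame (fun x => 3 * (u 0 x * (u 0 x * u 1 x))) :=
  (((S.tu 0 (by omega)).mul ((S.tu 0 (by omega)).mul (S.tu 1 (by omega))))).smul 3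

lemma deriv_cube (S : Slice ε β u v) (x : ℝ) :
    HasDerivAt (fun x => u 0 x * (u 0 x * u 0 x)) (3 * (u 0 x * (u 0 x * u 1 x))) x :=
  ((S.du 0 x).mul ((S.du 0 x).mul (S.du 0 x))).congr_deriv (by simp only [Pi.mul_apply]; ring)

/-- Integration by parts against `u³`. -/
lemma ibp_cube (S : Slice ε β u v) {g g' : ℝ → ℝ} (hg : Tame g) (hg' : Tame g')
    (dg : ∀ x, HasDerivAt g (g' x) x) :
    HasInt (fun x => 3 * (u 0 x * (u 0 x * u 1 x)) * g x
      + u 0 x * (u 0 x * u 0 x) * g' x) 0 :=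
  S.tame_cube.hasInt_ibp hg S.tame_cube_deriv hg' S.deriv_cube dg

/-- Integration by parts against `u ∂ₓu`. -/
lemma ibp_flux (S : Slice ε β u v) {g g' : ℝ → ℝ} (hg : Tame g) (hg' : Tame g')
    (dg : ∀ x, HasDerivAt g (g' x) x) :
    HasInt (fun x => (u 1 x * u 1 x + u 0 x * u 2 x) * g x + u 0 x * u 1 x * g' x) 0 :=
  ((S.tu 0 (by omega)).mul (S.tu 1 (by omega))).hasInt_ibp hg
    (((S.tu 1 (by omega)).mul (S.tu 1 (by omega))).add ((S.tu 0 (by omega)).mul (S.tu 2 (by omega))))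
    hg' (fun x => (S.du 0 x).mul (S.du 1 x)) dg

lemma hasInt_sq_mul_sq {f g : ℝ → ℝ} (hf : Tame f) (hg : Tame g) :
    HasInt (fun x => (f x * g x) ^ 2) (∫ x, (f x * g x) ^ 2) := (hf.mul hg).hasInt_sq

/-- The basic energy identity. -/
lemma rate_energy (S : Slice ε β u v) :
    2 * (∫ x, u 0 x * v 0 x) + β * (2 * ∫ x, u 1 x * v 1 x) + β ^ 2 * (2 * ∫ x, u 2 x * v 2 x)
      ≤ -2 * ε * ∫ x, u 1 x ^ 2 := by
  have u0 := S.tu 0 (by omega)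
  have u1 := S.tu 1 (by omega)
  have u2 := S.tu 2 (by omega)
  have v0 := S.tv 0 (by omega)
  have v1 := S.tv 1 (by omega)
  have v2 := S.tv 2 (by omega)
  have h := HasInt.le
    ((((u0.hasInt_mul v0).smul 2).add (((u1.hasInt_mul v1).smul 2).smul β)).add
      (((u2.hasInt_mul v2).smul 2).smul (β ^ 2)))
    ((((((((u1.hasInt_sq.smul (-2 * ε)).add ((S.ibp_uv 0 1 (by omega) (by omega)).smul (2 * β))).add
      ((S.ibp_uv 1 2 (by omega) (by omega)).smul (2 * β ^ 2))).add
      ((S.ibp_uv 0 3 (by omega) (by omega)).smul (-2 * β ^ 2))).add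
      ((S.ibp_uu 0 1 (by omega) (by omega)).smul (2 * ε))).add
      ((S.ibp_uu 0 2 (by omega) (by omega)).smul (-2 * β))).add
      ((S.ibp_uu 1 1 (by omega) (by omega)).smul β)).add
      (((u0.mul u0).hasInt_ibp u0 ((u1.mul u0).add (u0.mul u1)) u1
        (fun x => (S.du 0 x).mul (S.du 0 x)) (S.du 0)).smul (-4 / 3)))
    (fun x => le_of_eq (by linear_combination (2 * u 0 x) * S.pde x))
  linarith

/-- Rate of the first-order energy. -/
lemma rate_first (S : Slice ε β u v) (hε : 0 < ε) :
    2 * (∫ x, u 1 x * v 1 x) + β * (2 * ∫ x, u 2 x * v 2 x) + β ^ 2 * (2 * ∫ x, u 3 x * v 3 x)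
      ≤ -ε * (∫ x, u 2 x ^ 2) + 4 / ε * ∫ x, (u 0 x * u 1 x) ^ 2 := by
  have u0 := S.tu 0 (by omega)
  have u1 := S.tu 1 (by omega)
  have u2 := S.tu 2 (by omega)
  have u3 := S.tu 3 (by omega)
  have v1 := S.tv 1 (by omega)
  have v2 := S.tv 2 (by omega)
  have v3 := S.tv 3 (by omega)
  have h := HasInt.le
    ((((u1.hasInt_mul v1).smul 2).add (((u2.hasInt_mul v2).smul 2).smul β)).add
      (((u3.hasInt_mul v3).smul 2).smul (β ^ 2)))
    (((((u2.hasInt_sq.smul (-ε)).add ((hasInt_sq_mul_sq u0 u1).smul (4 / ε))).add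
      ((S.ibp_uv 1 0 (by omega) (by omega)).smul 2)).add
      ((S.ibp_uv 2 3 (by omega) (by omega)).smul (2 * β ^ 2))).add
      ((S.ibp_uu 2 2 (by omega) (by omega)).smul β))
    (fun x => by
      have h1 : 0 ≤ ε * (u 2 x - 2 / ε * (u 0 x * u 1 x)) ^ 2 := by positivity
      have h2 : ε * (u 2 x - 2 / ε * (u 0 x * u 1 x)) ^ 2 = ε * u 2 x ^ 2
          - 4 * (u 0 x * u 1 x * u 2 x) + 4 / ε * (u 0 x * u 1 x) ^ 2 := by
        field_simp
        ring
      rw [h2] at h1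
      linear_combination h1 - (2 * u 2 x) * S.pde x)
  linarith

/-- Rate of the second-order energy. -/
lemma rate_second (S : Slice ε β u v) (hε : 0 < ε) {m n : ℝ} (hm : ∀ x, u 0 x ^ 2 ≤ m)
    (hn : ∀ x, u 1 x ^ 2 ≤ n) :
    2 * (∫ x, u 2 x * v 2 x) + β * (2 * ∫ x, u 3 x * v 3 x) + β ^ 2 * (2 * ∫ x, u 4 x * v 4 x)
      ≤ 4 / ε * (n * (∫ x, u 1 x ^ 2) + m * ∫ x, u 2 x ^ 2) := by
  have u0 := S.tu 0 (by omega)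
  have u1 := S.tu 1 (by omega)
  have u2 := S.tu 2 (by omega)
  have u3 := S.tu 3 (by omega)
  have u4 := S.tu 4 (by omega)
  have v2 := S.tv 2 (by omega)
  have v3 := S.tv 3 (by omega)
  have v4 := S.tv 4 (by omega)
  have h := HasInt.le
    ((((u2.hasInt_mul v2).smul 2).add (((u3.hasInt_mul v3).smul 2).smul β)).add
      (((u4.hasInt_mul v4).smul 2).smul (β ^ 2)))
    (((((((((u1.hasInt_sq.smul n).add (u2.hasInt_sq.smul m)).smul (4 / ε)).add
      ((S.ibp_uv 2 1 (by omega) (by omega)).smul 2)).add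
      ((S.ibp_uv 3 0 (by omega) (by omega)).smul (-2))).add
      ((S.ibp_uv 3 2 (by omega) (by omega)).smul (2 * β))).add
      ((S.ibp_uu 3 2 (by omega) (by omega)).smul (2 * ε))).add
      ((S.ibp_uu 3 3 (by omega) (by omega)).smul (-β))).add
      ((S.ibp_flux u3 u4 (S.du 3)).smul (-4)))
    (fun x => by
      have key : 4 * ((u 1 x ^ 2 + u 0 x * u 2 x) * u 3 x) ≤ 2 * ε * u 3 x ^ 2
          + 4 / ε * (n * u 1 x ^ 2 + m * u 2 x ^ 2) := by
        have h1 : 0 ≤ ε * (u 3 x - 2 / ε * u 1 x ^ 2) ^ 2 := by positivity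
        have h2 : ε * (u 3 x - 2 / ε * u 1 x ^ 2) ^ 2 = ε * u 3 x ^ 2
            - 4 * (u 1 x ^ 2 * u 3 x) + 4 / ε * (u 1 x ^ 2 * u 1 x ^ 2) := by
          field_simp
          ring
        have h3 : 0 ≤ ε * (u 3 x - 2 / ε * (u 0 x * u 2 x)) ^ 2 := by positivity
        have h4 : ε * (u 3 x - 2 / ε * (u 0 x * u 2 x)) ^ 2 = ε * u 3 x ^ 2
            - 4 * (u 0 x * u 2 x * u 3 x) + 4 / ε * (u 0 x ^ 2 * u 2 x ^ 2) := by
          field_simp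
          ring
        have h5 : 4 / ε * (u 1 x ^ 2 * u 1 x ^ 2) ≤ 4 / ε * (n * u 1 x ^ 2) := by
          gcongr
          exact hn x
        have h6 : 4 / ε * (u 0 x ^ 2 * u 2 x ^ 2) ≤ 4 / ε * (m * u 2 x ^ 2) := by
          gcongr
          exact hm x
        linarith
      linear_combination key + (2 * u 4 x) * S.pde x)
  linarith

/-- Rate of the `L⁴` norm. -/
lemma rate_fourth (S : Slice ε β u v) (hε : 0 < ε) {m : ℝ} (hm : ∀ x, u 0 x ^ 2 ≤ m) :
    4 * (∫ x, u 0 x * (u 0 x * u 0 x) * v 0 x) ≤ -6 * ε * (∫ x, (u 0 x * u 1 x) ^ 2)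
      + 18 * m / ε * (β ^ 2 * (∫ x, u 2 x ^ 2) + β ^ 2 * (∫ x, v 1 x ^ 2)
        + β ^ 4 * ∫ x, v 3 x ^ 2) := by
  have u0 := S.tu 0 (by omega)
  have u1 := S.tu 1 (by omega)
  have u2 := S.tu 2 (by omega)
  have u3 := S.tu 3 (by omega)
  have v0 := S.tv 0 (by omega)
  have v1 := S.tv 1 (by omega)
  have v2 := S.tv 2 (by omega)
  have v3 := S.tv 3 (by omega)
  have v4 := S.tv 4 (by omega)
  have h := HasInt.le ((S.tame_cube.hasInt_mul v0).smul 4)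
    (((((((hasInt_sq_mul_sq u0 u1).smul (-6 * ε)).add
      ((((u2.hasInt_sq.smul (β ^ 2)).add (v1.hasInt_sq.smul (β ^ 2))).add
        (v3.hasInt_sq.smul (β ^ 4))).smul (18 * m / ε))).add
      ((S.ibp_cube u1 u2 (S.du 1)).smul (4 * ε))).add
      ((S.ibp_cube u2 u3 (S.du 2)).smul (-4 * β))).add
      (((S.ibp_cube v1 v2 (S.dv 1)).smul (4 * β)).add
      ((S.ibp_cube v3 v4 (S.dv 3)).smul (-4 * β ^ 2)))).add
      ((S.ibp_cube (u0.mul u0) ((u1.mul u0).add (u0.mul u1))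
        (fun x => (S.du 0 x).mul (S.du 0 x))).smul (-8 / 5)))
    (fun x => by
      have cs : ∀ c y : ℝ, 12 * (u 0 x ^ 2 * u 1 x * (c * y)) ≤
          2 * ε * (u 0 x * u 1 x) ^ 2 + 18 * m / ε * (c ^ 2 * y ^ 2) := by
        intro c y
        have h1 : 0 ≤ 2 * ε * u 0 x ^ 2 * (u 1 x - 3 / ε * (c * y)) ^ 2 := by positivity
        have h2 : 2 * ε * u 0 x ^ 2 * (u 1 x - 3 / ε * (c * y)) ^ 2 =
            2 * ε * (u 0 x * u 1 x) ^ 2 - 12 * (u 0 x ^ 2 * u 1 x * (c * y))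
              + 18 * u 0 x ^ 2 / ε * (c ^ 2 * y ^ 2) := by
          field_simp
          ring
        have h3 : 18 * u 0 x ^ 2 / ε * (c ^ 2 * y ^ 2) ≤ 18 * m / ε * (c ^ 2 * y ^ 2) := by
          gcongr
          exact hm x
        linarith
      linear_combination cs β (u 2 x) + cs (-β) (v 1 x) + cs (β ^ 2) (v 3 x)
        + (4 * u 0 x ^ 3) * S.pde x)
  linarith

/-- Rate of `‖∂ₓ²u‖²`, with the nonlinearity estimated by `‖u ∂ₓu‖²`. -/
lemma rate_parabolic (S : Slice ε β u v) (hε : 0 < ε) (hβ : 0 < β) :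
    β * ε ^ 2 * (2 * ∫ x, u 2 x * v 2 x) ≤ -2 * β * ε * (∫ x, v 1 x ^ 2)
      + -β ^ 3 * ε * (∫ x, v 3 x ^ 2) + 2 * ε * (∫ x, (u 0 x * u 1 x) ^ 2)
      + β * ε * ∫ x, u 2 x ^ 2 := by
  have u0 := S.tu 0 (by omega)
  have u1 := S.tu 1 (by omega)
  have u2 := S.tu 2 (by omega)
  have v1 := S.tv 1 (by omega)
  have v2 := S.tv 2 (by omega)
  have v3 := S.tv 3 (by omega)
  have h := HasInt.le (((u2.hasInt_mul v2).smul 2).smul (β * ε ^ 2))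
    (((((((v1.hasInt_sq.smul (-2 * β * ε)).add (v3.hasInt_sq.smul (-β ^ 3 * ε))).add
      ((hasInt_sq_mul_sq u0 u1).smul (2 * ε))).add (u2.hasInt_sq.smul (β * ε))).add
      ((S.ibp_vv 1 0 (by omega) (by omega)).smul (2 * β * ε))).add
      ((S.ibp_vv 3 2 (by omega) (by omega)).smul (2 * β ^ 3 * ε))).add
      ((S.ibp_uv 2 2 (by omega) (by omega)).smul (2 * β ^ 2 * ε)))
    (fun x => by
      have h1 : 0 ≤ 2 * ε * (β * v 2 x - u 0 x * u 1 x) ^ 2 := by positivity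
      have h2 : 0 ≤ β * ε * (β * v 3 x + u 2 x) ^ 2 := by positivity
      linear_combination h1 + h2 - (2 * β * ε * v 2 x) * S.pde x)
  linarith

/-- Rate of `‖∂ₓ²u‖²`, with the nonlinearity estimated by `‖∂ₓ(u ∂ₓu)‖²`. -/
lemma rate_parabolic' (S : Slice ε β u v) (hβ : 0 < β) {m : ℝ} (hm : ∀ x, u 0 x ^ 2 ≤ m) :
    β * ε * (2 * ∫ x, u 2 x * v 2 x) ≤ (40 * β * m + β / 2) * ∫ x, u 2 x ^ 2 := by
  have u0 := S.tu 0 (by omega)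
  have u1 := S.tu 1 (by omega)
  have u2 := S.tu 2 (by omega)
  have v1 := S.tv 1 (by omega)
  have v2 := S.tv 2 (by omega)
  have v3 := S.tv 3 (by omega)
  have h := HasInt.le (((u2.hasInt_mul v2).smul 2).smul (β * ε))
    ((((((u2.hasInt_sq.smul (40 * β * m + β / 2)).add
      ((S.ibp_vv 1 0 (by omega) (by omega)).smul (2 * β))).add
      ((S.ibp_vv 3 2 (by omega) (by omega)).smul (2 * β ^ 3))).add
      ((S.ibp_uv 2 2 (by omega) (by omega)).smul (2 * β ^ 2))).add
      ((S.ibp_flux v1 v2 (S.dv 1)).smul (4 * β))).add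
      ((((u0.mul u1).hasInt_ibp (u1.mul u1) ((u1.mul u1).add (u0.mul u2))
        ((u2.mul u1).add (u1.mul u2)) (fun x => (S.du 0 x).mul (S.du 1 x))
        (fun x => (S.du 1 x).mul (S.du 1 x))).smul (4 * β))))
    (fun x => by
      have h1 : 0 ≤ 2 * β * (v 1 x + (u 1 x ^ 2 + u 0 x * u 2 x)) ^ 2 := by positivity
      have h2 : 0 ≤ 2 * β * (β * v 3 x + u 2 x / 2) ^ 2 := by positivity
      have h3 : 0 ≤ 2 * β * (u 1 x ^ 2 + 2 * (u 0 x * u 2 x)) ^ 2 := by positivity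
      have h4 : 0 ≤ 30 * β * (u 0 x * u 2 x) ^ 2 := by positivity
      have h5 : 0 ≤ 40 * β * u 2 x ^ 2 * (m - u 0 x ^ 2) :=
        mul_nonneg (by positivity) (sub_nonneg.2 (hm x))
      have h6 : 0 ≤ 2 * β ^ 2 * v 2 x ^ 2 := by positivity
      linear_combination h1 + h2 + h3 + h4 + h5 + h6 - (2 * β * v 2 x) * S.pde x)
  linarith

end Slice
/-- The weight `1 / (1 + η² x²)`. -/
def weight (η x : ℝ) : ℝ := (1 + (η * x) ^ 2)⁻¹

/-- The derivative of `weight η`. -/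
def weightDeriv (η x : ℝ) : ℝ := -(2 * η ^ 2 * x) / (1 + (η * x) ^ 2) ^ 2

lemma weight_pos (η x : ℝ) : 0 < weight η x := by
  unfold weight
  positivity

lemma weight_le_one (η x : ℝ) : weight η x ≤ 1 :=
  inv_le_one_of_one_le₀ (by nlinarith [sq_nonneg (η * x)])

lemma continuous_weight (η : ℝ) : Continuous (weight η) := by
  unfold weight
  exact Continuous.inv₀ (by fun_prop) fun x => by positivity

lemma hasDerivAt_weight (η x : ℝ) : HasDerivAt (weight η) (weightDeriv η x) x := by
  have h : HasDerivAt (fun y : ℝ => 1 + (η * y) ^ 2) (2 * η ^ 2 * x) x := by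
    refine ((((hasDerivAt_id x).const_mul η).pow 2).const_add 1).congr_deriv ?_
    simp only [id]
    norm_num
    ring
  exact h.inv (by positivity)

lemma abs_weightDeriv_le {η : ℝ} (hη : 0 < η) (x : ℝ) :
    |weightDeriv η x| ≤ η * weight η x := by
  have hp : 0 < 1 + (η * x) ^ 2 := by positivity
  have hx : |2 * η * x| ≤ 1 + (η * x) ^ 2 := by
    rw [abs_le]
    constructor <;> nlinarith [sq_nonneg (η * x - 1), sq_nonneg (η * x + 1), sq_nonneg x]
  unfold weightDeriv weight
  rw [abs_div, abs_neg, abs_of_pos (pow_pos hp 2), div_le_iff₀ (pow_pos hp 2)]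
  have h1 : |2 * η ^ 2 * x| = η * |2 * η * x| := by
    rw [← abs_of_pos hη, ← abs_mul, abs_of_pos hη]
    ring_nf
  rw [h1]
  have h2 : η * (1 + (η * x) ^ 2)⁻¹ * (1 + (η * x) ^ 2) ^ 2 = η * (1 + (η * x) ^ 2) := by
    field_simp
  rw [h2]
  exact mul_le_mul_of_nonneg_left hx hη.le

lemma integrable_weight {η : ℝ} (hη : 0 < η) : Integrable (weight η) :=
  integrable_inv_one_add_sq.comp_mul_left' hη.ne'

lemma tame_weight {η : ℝ} (hη : 0 < η) : Tame (weight η) := by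
  refine ⟨continuous_weight η, ⟨1, fun x => ?_⟩, ?_⟩
  · rw [abs_of_pos (weight_pos η x)]
    exact weight_le_one η x
  · refine (integrable_weight hη).mono' ((continuous_weight η).pow 2).aestronglyMeasurable
      (Eventually.of_forall fun x => ?_)
    rw [norm_of_nonneg (sq_nonneg _)]
    nlinarith [weight_pos η x, weight_le_one η x]

lemma tame_weightDeriv {η : ℝ} (hη : 0 < η) : Tame (weightDeriv η) := by
  have hc : Continuous (weightDeriv η) := by
    unfold weightDeriv
    exact Continuous.div (by fun_prop) (by fun_prop) fun x => by positivity
  refine ⟨hc, ⟨η, fun x => (abs_weightDeriv_le hη x).trans ?_⟩, ?_⟩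
  · nlinarith [weight_le_one η x]
  · refine ((tame_weight hη).sq.const_mul (η ^ 2)).mono' (hc.pow 2).aestronglyMeasurable
      (Eventually.of_forall fun x => ?_)
    rw [norm_of_nonneg (sq_nonneg _), ← sq_abs, ← mul_pow]
    exact pow_le_pow_left₀ (abs_nonneg _) (abs_weightDeriv_le hη x) 2

lemma integrable_weight_mul {η : ℝ} {f : ℝ → ℝ} (hf : Integrable f) :
    Integrable (fun x => weight η x * f x) := by
  refine hf.norm.mono' ((continuous_weight η).aestronglyMeasurable.mul hf.1)
    (Eventually.of_forall fun x => ?_)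
  rw [norm_mul, norm_of_nonneg (weight_pos η x).le]
  exact mul_le_of_le_one_left (norm_nonneg _) (weight_le_one η x)

/-- Removing the weight in an integral bound. -/
lemma integral_le_of_weight {f : ℝ → ℝ} (hf : Integrable f) {K η₀ : ℝ} (h₀ : 0 < η₀)
    (h : ∀ η, 0 < η → η ≤ η₀ → ∫ x, weight η x * f x ≤ K) : ∫ x, f x ≤ K := by
  have hlim : Tendsto (fun η => ∫ x, weight η x * f x) (nhdsWithin 0 (Ioi 0))
      (nhds (∫ x, f x)) := by
    refine tendsto_integral_filter_of_dominated_convergence (fun x => ‖f x‖)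
      (Eventually.of_forall fun η => (integrable_weight_mul hf).1)
      (Eventually.of_forall fun η => Eventually.of_forall fun x => ?_) hf.norm
      (Eventually.of_forall fun x => ?_)
    · rw [norm_mul, norm_of_nonneg (weight_pos η x).le]
      exact mul_le_of_le_one_left (norm_nonneg _) (weight_le_one η x)
    · have hc : Continuous (fun η => weight η x * f x) := by
        unfold weight
        exact (Continuous.inv₀ (by fun_prop) fun x => by positivity).mul continuous_const
      have := (hc.tendsto 0).mono_left (nhdsWithin_le_nhds (s := Ioi 0))
      simpa [weight] using this
  refine le_of_tendsto hlim ?_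
  filter_upwards [Ioc_mem_nhdsGT h₀] with η hη using h η hη.1 hη.2

/-- Sum of the squares of the first five entries of a sequence of functions. -/
def sqSum (u : ℕ → ℝ → ℝ) (x : ℝ) : ℝ :=
  u 0 x ^ 2 + u 1 x ^ 2 + u 2 x ^ 2 + u 3 x ^ 2 + u 4 x ^ 2

lemma sq_le_sqSum (u : ℕ → ℝ → ℝ) {k : ℕ} (hk : k ≤ 4) (x : ℝ) : u k x ^ 2 ≤ sqSum u x := by
  unfold sqSum
  interval_cases k <;> nlinarith [sq_nonneg (u 0 x), sq_nonneg (u 1 x), sq_nonneg (u 2 x),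
    sq_nonneg (u 3 x), sq_nonneg (u 4 x)]

lemma integrable_sqSum {u : ℕ → ℝ → ℝ} (hu : ∀ k ≤ 4, Tame (u k)) : Integrable (sqSum u) :=
  ((((hu 0 (by omega)).sq.add (hu 1 (by omega)).sq).add (hu 2 (by omega)).sq).add
    (hu 3 (by omega)).sq).add (hu 4 (by omega)).sq

lemma Slice.ibp_weight {ε β : ℝ} {u v : ℕ → ℝ → ℝ} (S : Slice ε β u v) {η : ℝ} (hη : 0 < η)
    (i j : ℕ) (hi : i ≤ 3) (hj : j ≤ 3) :
    HasInt (fun x => (weightDeriv η x * v i x + weight η x * v (i + 1) x) * v j x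
      + weight η x * v i x * v (j + 1) x) 0 :=
  ((tame_weight hη).mul (S.tv i (by omega))).hasInt_ibp (S.tv j (by omega))
    (((tame_weightDeriv hη).mul (S.tv i (by omega))).add
      ((tame_weight hη).mul (S.tv (i + 1) (by omega)))) (S.tv (j + 1) (by omega))
    (fun x => (hasDerivAt_weight η x).mul (S.dv i x)) (S.dv j)

/-- Weighted elliptic estimate: the time derivatives are controlled by the solution, with a
constant that does not depend on the (slowly varying) weight. -/
lemma exists_weighted_elliptic (ε B : ℝ) {β : ℝ} (hβ : 0 < β) :
    ∃ η₀ > 0, ∃ C ≥ 0, ∀ u v : ℕ → ℝ → ℝ, Slice ε β u v → (∀ x, |u 0 x| ≤ B) →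
      ∀ η, 0 < η → η ≤ η₀ →
        ∫ x, weight η x * sqSum v x ≤ C * ∫ x, weight η x * sqSum u x := by
  obtain ⟨m, hm, h0, h1, h2, h3, h4⟩ : ∃ m : ℝ, 0 < m ∧ m ≤ 1 ∧ m ≤ β ∧ m ≤ β ^ 2 ∧ m ≤ β ^ 3 ∧
      m ≤ β ^ 4 := by
    refine ⟨min 1 (min β (min (β ^ 2) (min (β ^ 3) (β ^ 4)))), by positivity, ?_⟩
    simp only [min_le_iff, le_refl, true_or, or_true, and_self]
  have hd : 0 < β + β ^ 2 + β ^ 3 := by positivity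
  refine ⟨m / (2 * (β + β ^ 2 + β ^ 3)), by positivity,
    2 / m * (3 * (ε ^ 2 + β ^ 2 + 4 * B ^ 2)), by positivity, ?_⟩
  intro u v S hB η hη hη'
  rw [le_div_iff₀ (by positivity)] at hη'
  have h := HasInt.le ((integrable_weight_mul (η := η) (integrable_sqSum S.tv)).hasInt.smul (m / 2))
    ((((((integrable_weight_mul (η := η) (integrable_sqSum S.tu)).hasInt.smul
      (3 * (ε ^ 2 + β ^ 2 + 4 * B ^ 2))).add
      ((S.ibp_weight hη 0 1 (by omega) (by omega)).smul (2 * β))).add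
      ((S.ibp_weight hη 0 3 (by omega) (by omega)).smul (-2 * β ^ 2))).add
      ((S.ibp_weight hη 1 2 (by omega) (by omega)).smul (2 * β ^ 2))).add
      ((S.ibp_weight hη 2 3 (by omega) (by omega)).smul (2 * β ^ 3)))
    (fun x => by
      have hw := weight_pos η x
      have hw' := abs_le.1 (abs_weightDeriv_le hη x)
      set w := weight η x
      set w' := weightDeriv η x
      have cross : ∀ c p q : ℝ, 0 ≤ c → 0 ≤ c * (η * w * (p ^ 2 + q ^ 2) + 2 * w' * (p * q)) := by
        intro c p q hc
        refine mul_nonneg hc ?_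
        nlinarith [mul_nonneg (sub_nonneg.2 hw'.2) (sq_nonneg (p - q)),
          mul_nonneg (neg_le_iff_add_nonneg.1 hw'.1) (sq_nonneg (p + q))]
      have cross' : ∀ c p q : ℝ, 0 ≤ c →
          0 ≤ c * (η * w * (p ^ 2 + q ^ 2) - 2 * w' * (p * q)) := by
        intro c p q hc
        have := cross c p (-q) hc
        linear_combination this
      have hu0 : 0 ≤ (B ^ 2 - u 0 x ^ 2) * u 1 x ^ 2 :=
        mul_nonneg (sub_nonneg.2 (sq_le_sq' (abs_le.1 (hB x)).1 (abs_le.1 (hB x)).2)) (sq_nonneg _)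
      have hg : w * (v 0 x - β * v 2 x + β ^ 2 * v 4 x) ^ 2
          ≤ w * (3 * (ε ^ 2 + β ^ 2 + 4 * B ^ 2) * sqSum u x) := by
        refine mul_le_mul_of_nonneg_left ?_ hw.le
        have e : v 0 x - β * v 2 x + β ^ 2 * v 4 x
            = ε * u 2 x - β * u 3 x - 2 * (u 0 x * u 1 x) := by linear_combination S.pde x
        rw [e]
        have a1 : (ε * u 2 x - β * u 3 x - 2 * (u 0 x * u 1 x)) ^ 2
            ≤ 3 * (ε ^ 2 * u 2 x ^ 2 + β ^ 2 * u 3 x ^ 2 + 4 * B ^ 2 * u 1 x ^ 2) := by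
          linear_combination 12 * hu0 + sq_nonneg (ε * u 2 x + β * u 3 x)
            + sq_nonneg (ε * u 2 x + 2 * (u 0 x * u 1 x))
            + sq_nonneg (β * u 3 x - 2 * (u 0 x * u 1 x))
        have a2 := mul_le_mul_of_nonneg_left (sq_le_sqSum u (k := 2) (by omega) x) (sq_nonneg ε)
        have a3 := mul_le_mul_of_nonneg_left (sq_le_sqSum u (k := 3) (by omega) x) (sq_nonneg β)
        have a4 := mul_le_mul_of_nonneg_left (sq_le_sqSum u (k := 1) (by omega) x)
          (by positivity : 0 ≤ 4 * B ^ 2)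
        linarith
      have c0 : 0 ≤ (1 - η * (β + β ^ 2) - m / 2) * (w * v 0 x ^ 2) :=
        mul_nonneg (by nlinarith [pow_pos hβ 3]) (by positivity)
      have c1 : 0 ≤ (2 * β - η * (β + β ^ 2) - m / 2) * (w * v 1 x ^ 2) :=
        mul_nonneg (by nlinarith [pow_pos hβ 3]) (by positivity)
      have c2 : 0 ≤ (3 * β ^ 2 - η * (β ^ 2 + β ^ 3) - m / 2) * (w * v 2 x ^ 2) :=
        mul_nonneg (by nlinarith) (by positivity)
      have c3 : 0 ≤ (2 * β ^ 3 - η * (β ^ 2 + β ^ 3) - m / 2) * (w * v 3 x ^ 2) :=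
        mul_nonneg (by nlinarith) (by positivity)
      have c4 : 0 ≤ (β ^ 4 - m / 2) * (w * v 4 x ^ 2) :=
        mul_nonneg (by linarith) (by positivity)
      have k1 := cross β (v 0 x) (v 1 x) hβ.le
      have k2 := cross' (β ^ 2) (v 0 x) (v 3 x) (by positivity)
      have k3 := cross (β ^ 2) (v 1 x) (v 2 x) (by positivity)
      have k4 := cross (β ^ 3) (v 2 x) (v 3 x) (by positivity)
      simp only [sqSum] at hg ⊢
      linear_combination hg + c0 + c1 + c2 + c3 + c4 + k1 + k2 + k3 + k4)
  have h' : m / 2 * ∫ x, weight η x * sqSum v x ≤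
      3 * (ε ^ 2 + β ^ 2 + 4 * B ^ 2) * ∫ x, weight η x * sqSum u x := by linarith
  have h'' := mul_le_mul_of_nonneg_left h' (by positivity : 0 ≤ 2 / m)
  have e : 2 / m * (m / 2 * ∫ x, weight η x * sqSum v x) = ∫ x, weight η x * sqSum v x := by
    field_simp
  rw [e] at h''
  linarith
/-- Integrated form of differentiation under the integral sign. -/
lemma integral_sub_integral_eq {F F' : ℝ → ℝ → ℝ} {T B : ℝ} (hT : 0 < T)
    (hF : ∀ t x, HasDerivAt (fun s => F s x) (F' t x) t)
    (hc : Continuous (Function.uncurry F')) (h0 : Integrable (F 0)) (h1 : Integrable (F T))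
    (hI : ∀ t ∈ Ioc 0 T, Integrable (F' t)) (hB : ∀ t ∈ Ioc 0 T, ∫ x, |F' t x| ≤ B) :
    IntervalIntegrable (fun t => ∫ x, F' t x) volume 0 T ∧
      (∫ x, F T x) - ∫ x, F 0 x = ∫ t in (0 : ℝ)..T, ∫ x, F' t x := by
  have hprod : Integrable (Function.uncurry F') ((volume.restrict (Ioc 0 T)).prod volume) := by
    refine (integrable_prod_iff hc.aestronglyMeasurable).2 ⟨?_, ?_⟩
    · filter_upwards [ae_restrict_mem measurableSet_Ioc] with t ht using hI t ht
    · refine (integrable_const B).mono'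
        hc.aestronglyMeasurable.norm.integral_prod_right' ?_
      filter_upwards [ae_restrict_mem measurableSet_Ioc] with t ht
      rw [norm_of_nonneg (integral_nonneg fun x => norm_nonneg _)]
      exact hB t ht
  refine ⟨(intervalIntegrable_iff_integrableOn_Ioc_of_le hT.le).2 hprod.integral_prod_left, ?_⟩
  rw [← integral_sub h1 h0, intervalIntegral.integral_of_le hT.le,
    integral_integral_swap hprod]
  refine integral_congr_ae (Eventually.of_forall fun x => ?_)
  have hcx : Continuous (fun t => F' t x) := hc.comp (Continuous.prodMk_left x)
  have := intervalIntegral.integral_eq_sub_of_hasDerivAt (a := 0) (b := T)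
    (fun t _ => hF t x) (hcx.intervalIntegrable 0 T)
  rw [intervalIntegral.integral_of_le hT.le] at this
  exact this.symm

/-- `X` has the locally integrable derivative `R` on `(0, ∞)`, in integrated form. -/
def HasRate (X R : ℝ → ℝ) : Prop :=
  ∀ T > 0, IntervalIntegrable R volume 0 T ∧ X T - X 0 = ∫ t in (0 : ℝ)..T, R t

namespace HasRate

variable {X Y R Q : ℝ → ℝ}

lemma add (hX : HasRate X R) (hY : HasRate Y Q) :
    HasRate (fun t => X t + Y t) (fun t => R t + Q t) := fun T hT =>
  ⟨(hX T hT).1.add (hY T hT).1, by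
    rw [intervalIntegral.integral_add (hX T hT).1 (hY T hT).1, ← (hX T hT).2, ← (hY T hT).2]
    ring⟩

lemma smul (hX : HasRate X R) (c : ℝ) : HasRate (fun t => c * X t) (fun t => c * R t) :=
  fun T hT => ⟨(hX T hT).1.const_mul c, by
    rw [intervalIntegral.integral_const_mul, ← (hX T hT).2]
    ring⟩

lemma le_initial (hX : HasRate X R) (hR : ∀ t > 0, R t ≤ 0) {T : ℝ} (hT : 0 < T) :
    X T ≤ X 0 := by
  have h := (hX T hT).2
  rw [intervalIntegral.integral_of_le hT.le] at h
  have := setIntegral_nonpos (μ := volume) (s := Ioc 0 T) (f := R) measurableSet_Ioc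
    (fun t ht => hR t ht.1)
  linarith

end HasRate

/-- A time-dependent family of slices; `a k` and `v k` stand for `∂ₓᵏ u` and `∂ₜ∂ₓᵏ u`. -/
structure Evolution (ε β : ℝ) (a v : ℕ → ℝ → ℝ → ℝ) : Prop where
  slice : ∀ t > 0, Slice ε β (fun k => a k t) (fun k => v k t)
  tame : ∀ k ≤ 4, ∀ t ≥ 0, Tame (a k t)
  dt : ∀ k t x, HasDerivAt (fun s => a k s x) (v k t x) t
  cont_a : ∀ k, Continuous (Function.uncurry (a k))
  cont_v : ∀ k, Continuous (Function.uncurry (v k))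
  bdd : ∀ T > 0, ∃ B, ∀ k ≤ 4, ∀ t ∈ Icc 0 T, ∀ x, |a k t x| ≤ B ∧ |v k t x| ≤ B

lemma sqSum_nonneg (u : ℕ → ℝ → ℝ) (x : ℝ) : 0 ≤ sqSum u x := by
  unfold sqSum
  positivity

lemma sqSum_le {u : ℕ → ℝ → ℝ} {x B : ℝ} (h : ∀ k ≤ 4, |u k x| ≤ B) :
    sqSum u x ≤ 5 * B ^ 2 := by
  have h' : ∀ k ≤ 4, u k x ^ 2 ≤ B ^ 2 := fun k hk =>
    sq_le_sq' (abs_le.1 (h k hk)).1 (abs_le.1 (h k hk)).2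
  unfold sqSum
  linarith [h' 0 (by omega), h' 1 (by omega), h' 2 (by omega), h' 3 (by omega), h' 4 (by omega)]

lemma abs_pairing_le (u v : ℕ → ℝ → ℝ) (x : ℝ) :
    |2 * (u 0 x * v 0 x + u 1 x * v 1 x + u 2 x * v 2 x + u 3 x * v 3 x + u 4 x * v 4 x)|
      ≤ sqSum u x + sqSum v x := by
  unfold sqSum
  rw [abs_le]
  constructor
  · nlinarith [sq_nonneg (u 0 x + v 0 x), sq_nonneg (u 1 x + v 1 x), sq_nonneg (u 2 x + v 2 x),
      sq_nonneg (u 3 x + v 3 x), sq_nonneg (u 4 x + v 4 x)]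
  · nlinarith [sq_nonneg (u 0 x - v 0 x), sq_nonneg (u 1 x - v 1 x), sq_nonneg (u 2 x - v 2 x),
      sq_nonneg (u 3 x - v 3 x), sq_nonneg (u 4 x - v 4 x)]

namespace Evolution

variable {ε β : ℝ} {a v : ℕ → ℝ → ℝ → ℝ}

/-- Weighted Grönwall estimate. -/
lemma weighted_growth (E : Evolution ε β a v) {T B C η : ℝ} (hT : 0 < T) (hη : 0 < η)
    (hC : 0 ≤ C) (hB : ∀ k ≤ 4, ∀ t ∈ Icc 0 T, ∀ x, |a k t x| ≤ B ∧ |v k t x| ≤ B)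
    (hell : ∀ t ∈ Ioc 0 T, ∫ x, weight η x * sqSum (fun k => v k t) x
      ≤ C * ∫ x, weight η x * sqSum (fun k => a k t) x) :
    ∫ x, weight η x * sqSum (fun k => a k T) x
      ≤ exp ((1 + C) * T) * ∫ x, sqSum (fun k => a k 0) x := by
  have iS : ∀ t ≥ 0, Integrable (fun x => weight η x * sqSum (fun k => a k t) x) := fun t ht =>
    integrable_weight_mul (integrable_sqSum fun k hk => E.tame k hk t ht)
  have iV : ∀ t > 0, Integrable (fun x => weight η x * sqSum (fun k => v k t) x) := fun t ht =>
    integrable_weight_mul (integrable_sqSum (E.slice t ht).tv)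
  set F : ℝ → ℝ → ℝ := fun t x => exp (-(1 + C) * t) * (weight η x * sqSum (fun k => a k t) x)
    with hFdef
  set F' : ℝ → ℝ → ℝ := fun t x => exp (-(1 + C) * t) * (weight η x *
    (2 * (a 0 t x * v 0 t x + a 1 t x * v 1 t x + a 2 t x * v 2 t x + a 3 t x * v 3 t x
      + a 4 t x * v 4 t x) - (1 + C) * sqSum (fun k => a k t) x)) with hF'def
  have hd : ∀ t x, HasDerivAt (fun s => F s x) (F' t x) t := by
    intro t x
    have he : HasDerivAt (fun s => exp (-(1 + C) * s)) (exp (-(1 + C) * t) * (-(1 + C))) t := by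
      simpa using ((hasDerivAt_id t).const_mul (-(1 + C))).exp
    have hs : HasDerivAt (fun s => sqSum (fun k => a k s) x) (2 * (a 0 t x * v 0 t x
        + a 1 t x * v 1 t x + a 2 t x * v 2 t x + a 3 t x * v 3 t x + a 4 t x * v 4 t x)) t := by
      refine ((((((E.dt 0 t x).pow 2).add ((E.dt 1 t x).pow 2)).add ((E.dt 2 t x).pow 2)).add
        ((E.dt 3 t x).pow 2)).add ((E.dt 4 t x).pow 2)).congr_deriv ?_
      norm_num
      ring
    refine (he.mul (hs.const_mul (weight η x))).congr_deriv ?_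
    simp only [hF'def]
    ring
  have ca : ∀ k, Continuous fun p : ℝ × ℝ => a k p.1 p.2 := E.cont_a
  have cv : ∀ k, Continuous fun p : ℝ × ℝ => v k p.1 p.2 := E.cont_v
  have hc : Continuous (Function.uncurry F') := by
    have cw : Continuous fun p : ℝ × ℝ => weight η p.2 := (continuous_weight η).comp continuous_snd
    simp only [hF'def, sqSum, Function.uncurry_def]
    fun_prop
  have hbd : ∀ t ∈ Ioc 0 T, ∀ x, |F' t x| ≤ (1 + (1 + C)) * (5 * B ^ 2) * 2 * weight η x := by
    intro t ht x
    have hsa := sqSum_le (u := fun k => a k t) (x := x)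
      fun k hk => (hB k hk t (Ioc_subset_Icc_self ht) x).1
    have hsv := sqSum_le (u := fun k => v k t) (x := x)
      fun k hk => (hB k hk t (Ioc_subset_Icc_self ht) x).2
    have hp := abs_pairing_le (fun k => a k t) (fun k => v k t) x
    have hna := sqSum_nonneg (fun k => a k t) x
    have he : exp (-(1 + C) * t) ≤ 1 := exp_le_one_iff.2 (by nlinarith [ht.1])
    simp only [hF'def]
    rw [abs_mul, abs_of_pos (exp_pos _), abs_mul, abs_of_pos (weight_pos η x)]
    have h1 : |2 * (a 0 t x * v 0 t x + a 1 t x * v 1 t x + a 2 t x * v 2 t x + a 3 t x * v 3 t x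
      + a 4 t x * v 4 t x) - (1 + C) * sqSum (fun k => a k t) x|
        ≤ (1 + (1 + C)) * (5 * B ^ 2) * 2 := by
      refine (abs_sub _ _).trans ?_
      rw [abs_of_nonneg (mul_nonneg (by linarith : 0 ≤ 1 + C) hna)]
      have h2 : (1 + C) * sqSum (fun k => a k t) x ≤ (1 + C) * (5 * B ^ 2) :=
        mul_le_mul_of_nonneg_left hsa (by linarith)
      have h3 : 0 ≤ (1 + C) * (5 * B ^ 2) := by positivity
      linarith
    calc exp (-(1 + C) * t) * (weight η x * _)
        ≤ 1 * (weight η x * _) := mul_le_mul_of_nonneg_right he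
          (mul_nonneg (weight_pos η x).le (abs_nonneg _))
      _ ≤ _ := by
        rw [one_mul, mul_comm]
        exact mul_le_mul_of_nonneg_right h1 (weight_pos η x).le
  have hct : ∀ t, Continuous (F' t) := fun t => hc.comp (Continuous.prodMk_right t)
  have hI : ∀ t ∈ Ioc 0 T, Integrable (F' t) := fun t ht =>
    ((integrable_weight hη).const_mul _).mono' (hct t).aestronglyMeasurable
      (Eventually.of_forall (hbd t ht))
  have main := (integral_sub_integral_eq hT hd hc ((iS 0 le_rfl).const_mul _)
    ((iS T hT.le).const_mul _) hI (fun t ht => integral_mono (hI t ht).abs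
      ((integrable_weight hη).const_mul _) (hbd t ht))).2
  rw [intervalIntegral.integral_of_le hT.le] at main
  have hneg := setIntegral_nonpos (μ := volume) (s := Ioc 0 T) (f := fun t => ∫ x, F' t x)
    measurableSet_Ioc (fun t ht => by
      have h := HasInt.le (hI t ht).hasInt
        (((iV t ht.1).hasInt.add ((iS t ht.1.le).hasInt.smul (-C))).smul (exp (-(1 + C) * t)))
        (fun x => mul_le_mul_of_nonneg_left (by
          have hp := (abs_le.1 (abs_pairing_le (fun k => a k t) (fun k => v k t) x)).2
          have := mul_le_mul_of_nonneg_left hp (weight_pos η x).le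
          linarith) (exp_pos _).le)
      refine h.trans (mul_nonpos_of_nonneg_of_nonpos (exp_pos _).le ?_)
      linarith [hell t ht])
  have hle : ∫ x, F T x ≤ ∫ x, F 0 x := by linarith
  simp only [hFdef, integral_const_mul, mul_zero, exp_zero, one_mul] at hle
  have h0 : ∫ x, weight η x * sqSum (fun k => a k 0) x ≤ ∫ x, sqSum (fun k => a k 0) x :=
    integral_mono (iS 0 le_rfl) (integrable_sqSum fun k hk => E.tame k hk 0 le_rfl)
      fun x => mul_le_of_le_one_left (sqSum_nonneg _ _) (weight_le_one η x)
  have hm := mul_le_mul_of_nonneg_left (hle.trans h0) (exp_pos ((1 + C) * T)).le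
  rwa [← mul_assoc, ← exp_add, show (1 + C) * T + -(1 + C) * T = 0 by ring, exp_zero,
    one_mul] at hm

/-- The spatial `L²` norms are bounded locally uniformly in time. -/
lemma exists_uniform_bound (E : Evolution ε β a v) (hβ : 0 < β) {T : ℝ} (hT : 0 < T) :
    ∃ K, ∀ t ∈ Ioc 0 T, ∫ x, sqSum (fun k => a k t) x ≤ K ∧
      ∫ x, sqSum (fun k => v k t) x ≤ K := by
  obtain ⟨B, hB⟩ := E.bdd T hT
  obtain ⟨η₀, hη₀, C, hC, hell⟩ := exists_weighted_elliptic ε B hβ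
  have hA : 0 ≤ ∫ x, sqSum (fun k => a k 0) x := integral_nonneg fun x => sqSum_nonneg _ _
  have hell' : ∀ η, 0 < η → η ≤ η₀ → ∀ t ∈ Ioc 0 T,
      ∫ x, weight η x * sqSum (fun k => v k t) x
        ≤ C * ∫ x, weight η x * sqSum (fun k => a k t) x := fun η h1 h2 t ht =>
    hell _ _ (E.slice t ht.1) (fun x => (hB 0 (by omega) t (Ioc_subset_Icc_self ht) x).1) η h1 h2
  have hgr : ∀ η, 0 < η → η ≤ η₀ → ∀ t ∈ Ioc 0 T,
      ∫ x, weight η x * sqSum (fun k => a k t) x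
        ≤ exp ((1 + C) * T) * ∫ x, sqSum (fun k => a k 0) x := by
    intro η h1 h2 t ht
    refine (E.weighted_growth ht.1 h1 hC
      (fun k hk s hs => hB k hk s ⟨hs.1, hs.2.trans ht.2⟩)
      (fun s hs => hell' η h1 h2 s ⟨hs.1, hs.2.trans ht.2⟩)).trans ?_
    gcongr
    exact ht.2
  refine ⟨(1 + C) * (exp ((1 + C) * T) * ∫ x, sqSum (fun k => a k 0) x), fun t ht => ⟨?_, ?_⟩⟩
  · refine integral_le_of_weight (integrable_sqSum fun k hk => E.tame k hk t ht.1.le) hη₀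
      fun η h1 h2 => (hgr η h1 h2 t ht).trans ?_
    exact le_mul_of_one_le_left (by positivity) (by linarith)
  · refine integral_le_of_weight (integrable_sqSum (E.slice t ht.1).tv) hη₀
      fun η h1 h2 => (hell' η h1 h2 t ht).trans ?_
    refine (mul_le_mul_of_nonneg_left (hgr η h1 h2 t ht) hC).trans ?_
    exact mul_le_mul_of_nonneg_right (by linarith) (by positivity)

/-- Differentiation of `‖∂ₓᵏu‖²`. -/
lemma hasRate_sq (E : Evolution ε β a v) (hβ : 0 < β) {k : ℕ} (hk : k ≤ 4) :
    HasRate (fun t => ∫ x, a k t x ^ 2) (fun t => 2 * ∫ x, a k t x * v k t x) := by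
  intro T hT
  obtain ⟨K, hK⟩ := E.exists_uniform_bound hβ hT
  have ca : Continuous fun p : ℝ × ℝ => a k p.1 p.2 := E.cont_a k
  have cv : Continuous fun p : ℝ × ℝ => v k p.1 p.2 := E.cont_v k
  have hI : ∀ t > 0, Integrable (fun x => 2 * (a k t x * v k t x)) := fun t ht =>
    ((E.tame k hk t ht.le).integrable_mul ((E.slice t ht).tv k hk)).const_mul 2
  have h := integral_sub_integral_eq (F := fun t x => a k t x ^ 2)
    (F' := fun t x => 2 * (a k t x * v k t x)) (B := K + K) hT
    (fun t x => ((E.dt k t x).pow 2).congr_deriv (by norm_num; ring))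
    (by simp only [Function.uncurry_def]; fun_prop) (E.tame k hk 0 le_rfl).sq
    (E.tame k hk T hT.le).sq (fun t ht => hI t ht.1)
    (fun t ht => by
      refine (HasInt.le (hI t ht.1).abs.hasInt
        ((integrable_sqSum fun k hk => E.tame k hk t ht.1.le).hasInt.add
          (integrable_sqSum (E.slice t ht.1).tv).hasInt) fun x => ?_).trans
        (add_le_add (hK t ht).1 (hK t ht).2)
      have h1 := sq_le_sqSum (fun k => a k t) hk x
      have h2 := sq_le_sqSum (fun k => v k t) hk x
      rw [abs_le]
      constructor
      · nlinarith [sq_nonneg (a k t x + v k t x)]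
      · nlinarith [sq_nonneg (a k t x - v k t x)])
  simpa only [integral_const_mul] using h

/-- Differentiation of `‖u‖⁴` in `L⁴`. -/
lemma hasRate_fourth (E : Evolution ε β a v) (hβ : 0 < β) :
    HasRate (fun t => ∫ x, a 0 t x ^ 4)
      (fun t => 4 * ∫ x, a 0 t x * (a 0 t x * a 0 t x) * v 0 t x) := by
  intro T hT
  obtain ⟨K, hK⟩ := E.exists_uniform_bound hβ hT
  obtain ⟨B, hB⟩ := E.bdd T hT
  have ca : Continuous fun p : ℝ × ℝ => a 0 p.1 p.2 := E.cont_a 0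
  have cv : Continuous fun p : ℝ × ℝ => v 0 p.1 p.2 := E.cont_v 0
  have hI : ∀ t > 0, Integrable (fun x => 4 * (a 0 t x * (a 0 t x * a 0 t x) * v 0 t x)) :=
    fun t ht => ((E.slice t ht).tame_cube.integrable_mul
      ((E.slice t ht).tv 0 (by omega))).const_mul 4
  have hF : ∀ t ≥ 0, Integrable (fun x => a 0 t x ^ 4) := fun t ht => by
    have h0 := E.tame 0 (by omega) t ht
    have := (h0.mul h0).sq
    refine this.congr (Eventually.of_forall fun x => ?_)
    simp only
    ring
  have h := integral_sub_integral_eq (F := fun t x => a 0 t x ^ 4)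
    (F' := fun t x => 4 * (a 0 t x * (a 0 t x * a 0 t x) * v 0 t x))
    (B := 2 * B ^ 2 * (K + K)) hT
    (fun t x => ((E.dt 0 t x).pow 4).congr_deriv (by norm_num; ring))
    (by simp only [Function.uncurry_def]; fun_prop) (hF 0 le_rfl) (hF T hT.le)
    (fun t ht => hI t ht.1)
    (fun t ht => by
      refine (HasInt.le (hI t ht.1).abs.hasInt
        (((integrable_sqSum fun k hk => E.tame k hk t ht.1.le).hasInt.add
          (integrable_sqSum (E.slice t ht.1).tv).hasInt).smul (2 * B ^ 2)) fun x => ?_).trans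
        (mul_le_mul_of_nonneg_left (add_le_add (hK t ht).1 (hK t ht).2) (by positivity))
      have h1 := sq_le_sqSum (fun k => a k t) (k := 0) (by omega) x
      have h2 := sq_le_sqSum (fun k => v k t) (k := 0) (by omega) x
      have hb := abs_le.1 (hB 0 (by omega) t (Ioc_subset_Icc_self ht) x).1
      have h3 : a 0 t x ^ 2 ≤ B ^ 2 := sq_le_sq' hb.1 hb.2
      have h4 : |4 * (a 0 t x * (a 0 t x * a 0 t x) * v 0 t x)|
          = 2 * a 0 t x ^ 2 * |2 * (a 0 t x * v 0 t x)| := by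
        rw [← abs_of_nonneg (by positivity : 0 ≤ 2 * a 0 t x ^ 2), ← abs_mul]
        ring_nf
      rw [h4]
      have h5 : |2 * (a 0 t x * v 0 t x)| ≤ a 0 t x ^ 2 + v 0 t x ^ 2 := by
        rw [abs_le]
        constructor
        · nlinarith [sq_nonneg (a 0 t x + v 0 t x)]
        · nlinarith [sq_nonneg (a 0 t x - v 0 t x)]
      exact mul_le_mul (by linarith) (h5.trans (add_le_add h1 h2)) (abs_nonneg _)
        (by positivity))
  simpa only [integral_const_mul] using h

end Evolution
/-- Partial derivative in the second variable. -/
def partialX (G : ℝ × ℝ → ℝ) (p : ℝ × ℝ) : ℝ := fderiv ℝ G p (0, 1)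

/-- Partial derivative in the first variable. -/
def partialT (G : ℝ × ℝ → ℝ) (p : ℝ × ℝ) : ℝ := fderiv ℝ G p (1, 0)

section Partial

variable {G : ℝ × ℝ → ℝ}

lemma ContDiff.partialX (hG : ContDiff ℝ (⊤ : ℕ∞) G) : ContDiff ℝ (⊤ : ℕ∞) (partialX G) :=
  (hG.fderiv_right (by simp)).clm_apply contDiff_const

lemma ContDiff.partialT (hG : ContDiff ℝ (⊤ : ℕ∞) G) : ContDiff ℝ (⊤ : ℕ∞) (partialT G) :=
  (hG.fderiv_right (by simp)).clm_apply contDiff_const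

lemma ContDiff.iterate_partialX (hG : ContDiff ℝ (⊤ : ℕ∞) G) (k : ℕ) :
    ContDiff ℝ (⊤ : ℕ∞) (_root_.partialX^[k] G) := by
  induction k with
  | zero => exact hG
  | succ k ih =>
    rw [Function.iterate_succ_apply']
    exact ih.partialX

lemma hasDerivAt_partialX (hG : ContDiff ℝ (⊤ : ℕ∞) G) (t x : ℝ) :
    HasDerivAt (fun y => G (t, y)) (partialX G (t, x)) x :=
  (hG.differentiable (by simp) (t, x)).hasFDerivAt.comp_hasDerivAt x
    ((hasDerivAt_const x t).prodMk (hasDerivAt_id x))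

lemma hasDerivAt_partialT (hG : ContDiff ℝ (⊤ : ℕ∞) G) (t x : ℝ) :
    HasDerivAt (fun s => G (s, x)) (partialT G (t, x)) t :=
  (hG.differentiable (by simp) (t, x)).hasFDerivAt.comp_hasDerivAt t
    ((hasDerivAt_id t).prodMk (hasDerivAt_const t x))

lemma partialX_partialT (hG : ContDiff ℝ (⊤ : ℕ∞) G) :
    partialX (partialT G) = partialT (partialX G) := by
  funext p
  have hd : DifferentiableAt ℝ (fderiv ℝ G) p :=
    (hG.fderiv_right (m := (⊤ : ℕ∞)) (by simp)).differentiable (by simp) p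
  have hs : IsSymmSndFDerivAt ℝ G p :=
    hG.contDiffAt.isSymmSndFDerivAt (by
      rw [minSmoothness_of_isRCLikeNormedField]
      exact WithTop.coe_le_coe.2 (le_top : (2 : ℕ∞) ≤ ⊤))
  have key : ∀ w z : ℝ × ℝ,
      fderiv ℝ (fun q => fderiv ℝ G q w) p z = fderiv ℝ (fderiv ℝ G) p z w := by
    intro w z
    rw [fderiv_clm_apply hd (differentiableAt_const w)]
    simp
  change fderiv ℝ (fun q => fderiv ℝ G q (1, 0)) p (0, 1)
    = fderiv ℝ (fun q => fderiv ℝ G q (0, 1)) p (1, 0)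
  rw [key, key, hs.eq]

end Partial

section MixedD

variable {u : ℝ → ℝ → ℝ}

lemma iteratedDeriv_eq_iterate_partialX
    (hu : ContDiff ℝ (⊤ : ℕ∞) (fun p : ℝ × ℝ => u p.1 p.2)) (k : ℕ) (t x : ℝ) :
    iteratedDeriv k (fun y => u t y) x = (partialX^[k] fun p : ℝ × ℝ => u p.1 p.2) (t, x) := by
  induction k generalizing x with
  | zero => simp
  | succ k ih =>
    rw [iteratedDeriv_succ, Function.iterate_succ_apply', funext ih]
    exact (hasDerivAt_partialX (hu.iterate_partialX k) t x).deriv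

lemma mixedD_zero_eq (hu : ContDiff ℝ (⊤ : ℕ∞) (fun p : ℝ × ℝ => u p.1 p.2)) (k : ℕ) (t x : ℝ) :
    mixedD u 0 k t x = (partialX^[k] fun p : ℝ × ℝ => u p.1 p.2) (t, x) := by
  rw [mixedD, iteratedDeriv_zero, iteratedDeriv_eq_iterate_partialX hu]

lemma mixedD_one_eq (hu : ContDiff ℝ (⊤ : ℕ∞) (fun p : ℝ × ℝ => u p.1 p.2)) (k : ℕ) (t x : ℝ) :
    mixedD u 1 k t x = partialT (partialX^[k] fun p : ℝ × ℝ => u p.1 p.2) (t, x) := by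
  rw [mixedD, iteratedDeriv_one,
    funext fun s => iteratedDeriv_eq_iterate_partialX hu k s x]
  exact (hasDerivAt_partialT (hu.iterate_partialX k) t x).deriv

lemma continuous_mixedD (hu : ContDiff ℝ (⊤ : ℕ∞) (fun p : ℝ × ℝ => u p.1 p.2)) {j : ℕ}
    (hj : j ≤ 1) (k : ℕ) : Continuous (Function.uncurry (mixedD u j k)) := by
  interval_cases j
  · exact (hu.iterate_partialX k).continuous.congr fun p => (mixedD_zero_eq hu k p.1 p.2).symm
  · exact (hu.iterate_partialX k).partialT.continuous.congr
      fun p => (mixedD_one_eq hu k p.1 p.2).symm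

lemma hasDerivAt_mixedD (hu : ContDiff ℝ (⊤ : ℕ∞) (fun p : ℝ × ℝ => u p.1 p.2)) {j : ℕ}
    (hj : j ≤ 1) (k : ℕ) (t x : ℝ) : HasDerivAt (mixedD u j k t) (mixedD u j (k + 1) t x) x := by
  interval_cases j
  · rw [mixedD_zero_eq hu, Function.iterate_succ_apply', funext (mixedD_zero_eq hu k t)]
    exact hasDerivAt_partialX (hu.iterate_partialX k) t x
  · rw [mixedD_one_eq hu, Function.iterate_succ_apply', funext (mixedD_one_eq hu k t),
      ← partialX_partialT (hu.iterate_partialX k)]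
    exact hasDerivAt_partialX (hu.iterate_partialX k).partialT t x

lemma hasDerivAt_mixedD_time (hu : ContDiff ℝ (⊤ : ℕ∞) (fun p : ℝ × ℝ => u p.1 p.2)) (k : ℕ)
    (t x : ℝ) : HasDerivAt (fun s => mixedD u 0 k s x) (mixedD u 1 k t x) t := by
  rw [mixedD_one_eq hu, funext fun s => mixedD_zero_eq hu k s x]
  exact hasDerivAt_partialT (hu.iterate_partialX k) t x

end MixedD

namespace IsAdmissibleKdVRLW

variable {ε β : ℝ} {u : ℝ → ℝ → ℝ}

lemma exists_bound (h : IsAdmissibleKdVRLW ε β u) {T : ℝ} (hT : 0 < T) {j k : ℕ} (hj : j ≤ 1)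
    (hk : k ≤ 4) : ∃ B, ∀ t ∈ Icc 0 T, ∀ x, |mixedD u j k t x| ≤ B := by
  obtain ⟨M, hM⟩ := h.decay T hT j k (by omega) 1 one_pos
  obtain ⟨B, hB⟩ := (isCompact_Icc.prod isCompact_Icc :
    IsCompact (Icc (0 : ℝ) T ×ˢ Icc (-M) M)).exists_bound_of_continuousOn
    (continuous_mixedD h.smooth hj k).continuousOn
  refine ⟨max 1 B, fun t ht x => ?_⟩
  rcases le_total M |x| with hx | hx
  · exact (hM x hx t ht).trans (le_max_left _ _)
  · exact (hB (t, x) ⟨ht, abs_le.1 hx⟩).trans (le_max_right _ _)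

lemma tame (h : IsAdmissibleKdVRLW ε β u) {j k : ℕ} (hj : j ≤ 1) (hk : k ≤ 4) {t : ℝ}
    (ht : 0 ≤ t) : Tame (mixedD u j k t) := by
  have hT : 0 < t + 1 := by linarith
  have hm : t ∈ Icc 0 (t + 1) := ⟨ht, by linarith⟩
  obtain ⟨B, hB⟩ := h.exists_bound hT hj hk
  exact ⟨(continuous_mixedD h.smooth hj k).comp (Continuous.prodMk_right t), ⟨B, hB t hm⟩,
    h.sq_int _ hT j k (by omega) t hm⟩

lemma evolution (h : IsAdmissibleKdVRLW ε β u) : Evolution ε β (mixedD u 0) (mixedD u 1) where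
  slice t ht :=
    { tu := fun k hk => h.tame (by omega) hk ht.le
      tv := fun k hk => h.tame le_rfl hk ht.le
      du := fun k x => hasDerivAt_mixedD h.smooth (by omega) k t x
      dv := fun k x => hasDerivAt_mixedD h.smooth le_rfl k t x
      pde := fun x => by
        have h0 : (fun y => u t y) = mixedD u 0 0 t := by
          funext y
          simp [mixedD]
        have hd : deriv (fun y => u t y ^ 2) x = 2 * (mixedD u 0 0 t x * mixedD u 0 1 t x) := by
          have h1 : HasDerivAt (fun y => u t y) (mixedD u 0 1 t x) x := by
            rw [h0]
            exact hasDerivAt_mixedD h.smooth (by omega) 0 t x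
          rw [(h1.fun_pow 2).deriv, ← h0]
          norm_num
          ring
        have := h.pde t ht x
        rwa [hd] at this }
  tame k hk t ht := h.tame (by omega) hk ht
  dt k t x := hasDerivAt_mixedD_time h.smooth k t x
  cont_a k := continuous_mixedD h.smooth (by omega) k
  cont_v k := continuous_mixedD h.smooth le_rfl k
  bdd T hT := by
    have hex : ∀ j ≤ 1, ∃ B, ∀ k ≤ 4, ∀ t ∈ Icc 0 T, ∀ x, |mixedD u j k t x| ≤ B := by
      intro j hj
      choose! b hb using fun k (hk : k ≤ 4) => h.exists_bound hT hj hk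
      refine ⟨∑ k ∈ Finset.range 5, |b k|, fun k hk t ht x => ?_⟩
      refine ((hb k hk t ht x).trans (le_abs_self _)).trans ?_
      exact Finset.single_le_sum (f := fun k => |b k|) (fun i _ => abs_nonneg _)
        (Finset.mem_range.2 (by omega))
    obtain ⟨B, hB⟩ := hex 0 (by omega)
    obtain ⟨B', hB'⟩ := hex 1 le_rfl
    exact ⟨max B B', fun k hk t ht x => ⟨(hB k hk t ht x).trans (le_max_left _ _),
      (hB' k hk t ht x).trans (le_max_right _ _)⟩⟩

end IsAdmissibleKdVRLW
/-- The energy balances satisfied by `X k = ‖∂ₓᵏu‖²`, `Y k = ‖∂ₜ∂ₓᵏu‖²`, `Z = ‖u ∂ₓu‖²` and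
`Q = ‖u‖⁴` (in `L⁴`), with time derivatives `r k` of `X k` and `q` of `Q`. -/
structure EnergyBalance (ε β : ℝ) (X Y r : ℕ → ℝ → ℝ) (Z Q q : ℝ → ℝ) : Prop where
  rate : ∀ k ≤ 4, HasRate (X k) (r k)
  rateQ : HasRate Q q
  posX : ∀ k t, 0 ≤ X k t
  posY : ∀ k t, 0 ≤ Y k t
  posZ : ∀ t, 0 ≤ Z t
  posQ : ∀ t, 0 ≤ Q t
  energy : ∀ t > 0, r 0 t + β * r 1 t + β ^ 2 * r 2 t ≤ -2 * ε * X 1 t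
  agmon : ∀ t > 0, ∀ s > 0, Z t ≤ (s * X 0 t + s⁻¹ * X 1 t) * X 1 t
  first : ∀ t > 0, r 1 t + β * r 2 t + β ^ 2 * r 3 t ≤ -ε * X 2 t + 4 / ε * Z t
  second : ∀ t > 0, ∀ s > 0, r 2 t + β * r 3 t + β ^ 2 * r 4 t
    ≤ 4 / ε * ((s * X 1 t + s⁻¹ * X 2 t) * X 1 t + (s * X 0 t + s⁻¹ * X 1 t) * X 2 t)
  fourth : ∀ t > 0, ∀ s > 0, q t ≤ -6 * ε * Z t
    + 18 * (s * X 0 t + s⁻¹ * X 1 t) / ε * (β ^ 2 * X 2 t + β ^ 2 * Y 1 t + β ^ 4 * Y 3 t)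
  parabolic : ∀ t > 0, β * ε ^ 2 * r 2 t ≤ -2 * β * ε * Y 1 t + -β ^ 3 * ε * Y 3 t
    + 2 * ε * Z t + β * ε * X 2 t
  parabolic' : ∀ t > 0, ∀ s > 0,
    β * ε * r 2 t ≤ (40 * β * (s * X 0 t + s⁻¹ * X 1 t) + β / 2) * X 2 t

lemma Evolution.energyBalance {ε β : ℝ} {a v : ℕ → ℝ → ℝ → ℝ} (E : Evolution ε β a v)
    (hε : 0 < ε) (hβ : 0 < β) :
    EnergyBalance ε β (fun k t => ∫ x, a k t x ^ 2) (fun k t => ∫ x, v k t x ^ 2)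
      (fun k t => 2 * ∫ x, a k t x * v k t x) (fun t => ∫ x, (a 0 t x * a 1 t x) ^ 2)
      (fun t => ∫ x, a 0 t x ^ 4) (fun t => 4 * ∫ x, a 0 t x * (a 0 t x * a 0 t x) * v 0 t x) := by
  have sup : ∀ k ≤ 3, ∀ t > 0, ∀ s > 0, ∀ x, a k t x ^ 2
      ≤ s * (∫ y, a k t y ^ 2) + s⁻¹ * ∫ y, a (k + 1) t y ^ 2 := fun k hk t ht s hs x =>
    ((E.slice t ht).tu k (by omega)).sq_le ((E.slice t ht).tu (k + 1) (by omega))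
      ((E.slice t ht).du k) hs x
  exact
    { rate := fun k hk => E.hasRate_sq hβ hk
      rateQ := E.hasRate_fourth hβ
      posX := fun k t => integral_nonneg fun x => sq_nonneg _
      posY := fun k t => integral_nonneg fun x => sq_nonneg _
      posZ := fun t => integral_nonneg fun x => sq_nonneg _
      posQ := fun t => integral_nonneg fun x => by positivity
      energy := fun t ht => (E.slice t ht).rate_energy
      agmon := fun t ht s hs => by
        have S := E.slice t ht
        exact (Slice.hasInt_sq_mul_sq (S.tu 0 (by omega)) (S.tu 1 (by omega))).le
          ((S.tu 1 (by omega)).hasInt_sq.smul _) fun x => by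
            rw [mul_pow]
            exact mul_le_mul_of_nonneg_right (sup 0 (by omega) t ht s hs x) (sq_nonneg _)
      first := fun t ht => (E.slice t ht).rate_first hε
      second := fun t ht s hs => (E.slice t ht).rate_second hε (sup 0 (by omega) t ht s hs)
        (sup 1 (by omega) t ht s hs)
      fourth := fun t ht s hs => (E.slice t ht).rate_fourth hε (sup 0 (by omega) t ht s hs)
      parabolic := fun t ht => (E.slice t ht).rate_parabolic hε hβ
      parabolic' := fun t ht s hs => (E.slice t ht).rate_parabolic' hβ
        (sup 0 (by omega) t ht s hs) }

namespace EnergyBalance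

variable {ε b K : ℝ} {X Y r : ℕ → ℝ → ℝ} {Z Q q : ℝ → ℝ}

lemma energy_le (H : EnergyBalance ε (b ^ 2) X Y r Z Q q) (hε : 0 < ε) {t : ℝ} (ht : 0 < t) :
    X 0 t + b ^ 2 * X 1 t + (b ^ 2) ^ 2 * X 2 t
      ≤ X 0 0 + b ^ 2 * X 1 0 + (b ^ 2) ^ 2 * X 2 0 :=
  (((H.rate 0 (by omega)).add ((H.rate 1 (by omega)).smul _)).add
    ((H.rate 2 (by omega)).smul _)).le_initial (fun s hs => (H.energy s hs).trans (by
      have := mul_nonneg hε.le (H.posX 1 s)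
      linarith)) ht

/-- The Agmon bound on `‖u‖∞²` given by the energy. -/
lemma sup_le (H : EnergyBalance ε (b ^ 2) X Y r Z Q q) (hb : 0 < b) {t : ℝ}
    (hE : X 0 t + b ^ 2 * X 1 t + (b ^ 2) ^ 2 * X 2 t ≤ K) :
    b⁻¹ * X 0 t + b⁻¹⁻¹ * X 1 t ≤ K / b := by
  have h2 := mul_nonneg (by positivity : 0 ≤ (b ^ 2) ^ 2) (H.posX 2 t)
  rw [le_div_iff₀ hb, inv_inv]
  have : (b⁻¹ * X 0 t + b * X 1 t) * b = X 0 t + b ^ 2 * X 1 t := by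
    field_simp
  linarith

/-- The Agmon bound on `‖∂ₓu‖∞²` given by the energy. -/
lemma sup_deriv_le (H : EnergyBalance ε (b ^ 2) X Y r Z Q q) (hb : 0 < b) {t : ℝ}
    (hE : X 0 t + b ^ 2 * X 1 t + (b ^ 2) ^ 2 * X 2 t ≤ K) :
    b⁻¹ * X 1 t + b⁻¹⁻¹ * X 2 t ≤ K / b ^ 3 := by
  rw [le_div_iff₀ (by positivity), inv_inv]
  have : (b⁻¹ * X 1 t + b * X 2 t) * b ^ 3 = b ^ 2 * X 1 t + (b ^ 2) ^ 2 * X 2 t := by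
    field_simp
  linarith [H.posX 0 t]

lemma first_rate_le (H : EnergyBalance ε (b ^ 2) X Y r Z Q q) (hε : 0 < ε) (hb : 0 < b)
    (hE : ∀ t > 0, X 0 t + b ^ 2 * X 1 t + (b ^ 2) ^ 2 * X 2 t ≤ K) (hK : 18 * K * b ≤ ε ^ 2)
    {t : ℝ} (ht : 0 < t) :
    b ^ 2 * (r 1 t + b ^ 2 * r 2 t + (b ^ 2) ^ 2 * r 3 t)
      + 1 / 9 * (r 0 t + b ^ 2 * r 1 t + (b ^ 2) ^ 2 * r 2 t) ≤ -(ε * (b ^ 2 * X 2 t)) := by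
  have h1 := mul_le_mul_of_nonneg_left (H.first t ht) (by positivity : 0 ≤ b ^ 2)
  have hZ : Z t ≤ K / b * X 1 t := (H.agmon t ht b⁻¹ (by positivity)).trans
    (mul_le_mul_of_nonneg_right (H.sup_le hb (hE t ht)) (H.posX 1 t))
  have h2 : b ^ 2 * (4 / ε * Z t) ≤ b ^ 2 * (4 / ε * (K / b * X 1 t)) := by gcongr
  have h3 : b ^ 2 * (4 / ε * (K / b * X 1 t)) = 4 * (K * b / ε) * X 1 t := by
    field_simp
  have h4 : K * b / ε ≤ ε / 18 := by
    rw [div_le_iff₀ hε]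
    linarith
  have h5 := mul_le_mul_of_nonneg_right h4 (H.posX 1 t)
  linarith [H.energy t ht]

lemma first_le (H : EnergyBalance ε (b ^ 2) X Y r Z Q q) (hε : 0 < ε) (hb : 0 < b)
    (hE : ∀ t > 0, X 0 t + b ^ 2 * X 1 t + (b ^ 2) ^ 2 * X 2 t ≤ K) (hK : 18 * K * b ≤ ε ^ 2)
    {t : ℝ} (ht : 0 < t) :
    b ^ 2 * (X 1 t + b ^ 2 * X 2 t + (b ^ 2) ^ 2 * X 3 t)
      + 1 / 9 * (X 0 t + b ^ 2 * X 1 t + (b ^ 2) ^ 2 * X 2 t)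
      ≤ b ^ 2 * (X 1 0 + b ^ 2 * X 2 0 + (b ^ 2) ^ 2 * X 3 0)
        + 1 / 9 * (X 0 0 + b ^ 2 * X 1 0 + (b ^ 2) ^ 2 * X 2 0) :=
  (((((H.rate 1 (by omega)).add ((H.rate 2 (by omega)).smul _)).add
    ((H.rate 3 (by omega)).smul _)).smul _).add
    ((((H.rate 0 (by omega)).add ((H.rate 1 (by omega)).smul _)).add
    ((H.rate 2 (by omega)).smul _)).smul _)).le_initial
    (fun s hs => (H.first_rate_le hε hb hE hK hs).trans (by
      have := H.posX 2 s
      have : 0 ≤ ε * (b ^ 2 * X 2 s) := by positivity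
      linarith)) ht

lemma second_le (H : EnergyBalance ε (b ^ 2) X Y r Z Q q) (hε : 0 < ε) (hb : 0 < b)
    (hE : ∀ t > 0, X 0 t + b ^ 2 * X 1 t + (b ^ 2) ^ 2 * X 2 t ≤ K) (hK : 18 * K * b ≤ ε ^ 2)
    {t : ℝ} (ht : 0 < t) :
    (b ^ 2) ^ 2 * (X 2 t + b ^ 2 * X 3 t + (b ^ 2) ^ 2 * X 4 t)
      + 1 / 9 * (X 0 t + b ^ 2 * X 1 t + (b ^ 2) ^ 2 * X 2 t)
      + 2 / 9 * (b ^ 2 * (X 1 t + b ^ 2 * X 2 t + (b ^ 2) ^ 2 * X 3 t)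
      + 1 / 9 * (X 0 t + b ^ 2 * X 1 t + (b ^ 2) ^ 2 * X 2 t))
      ≤ (b ^ 2) ^ 2 * (X 2 0 + b ^ 2 * X 3 0 + (b ^ 2) ^ 2 * X 4 0)
      + 1 / 9 * (X 0 0 + b ^ 2 * X 1 0 + (b ^ 2) ^ 2 * X 2 0)
      + 2 / 9 * (b ^ 2 * (X 1 0 + b ^ 2 * X 2 0 + (b ^ 2) ^ 2 * X 3 0)
      + 1 / 9 * (X 0 0 + b ^ 2 * X 1 0 + (b ^ 2) ^ 2 * X 2 0)) := by
  have e0 := ((H.rate 0 (by omega)).add ((H.rate 1 (by omega)).smul (b ^ 2))).add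
    ((H.rate 2 (by omega)).smul ((b ^ 2) ^ 2))
  have e1 := ((H.rate 1 (by omega)).add ((H.rate 2 (by omega)).smul (b ^ 2))).add
    ((H.rate 3 (by omega)).smul ((b ^ 2) ^ 2))
  have e2 := ((H.rate 2 (by omega)).add ((H.rate 3 (by omega)).smul (b ^ 2))).add
    ((H.rate 4 (by omega)).smul ((b ^ 2) ^ 2))
  refine (((e2.smul _).add (e0.smul _)).add (((e1.smul _).add (e0.smul _)).smul _)).le_initial
    (fun s hs => ?_) ht
  have h0 := H.energy s hs
  have h1 := H.first_rate_le hε hb hE hK hs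
  have h2 := mul_le_mul_of_nonneg_left (H.second s hs b⁻¹ (by positivity))
    (by positivity : 0 ≤ (b ^ 2) ^ 2)
  have x1 := H.posX 1 s
  have x2 := H.posX 2 s
  have h3 : (b ^ 2) ^ 2 * (4 / ε * ((b⁻¹ * X 1 s + b⁻¹⁻¹ * X 2 s) * X 1 s
      + (b⁻¹ * X 0 s + b⁻¹⁻¹ * X 1 s) * X 2 s))
      ≤ (b ^ 2) ^ 2 * (4 / ε * (K / b ^ 3 * X 1 s + K / b * X 2 s)) := by
    gcongr
    · exact H.sup_deriv_le hb (hE s hs)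
    · exact H.sup_le hb (hE s hs)
  have h4 : (b ^ 2) ^ 2 * (4 / ε * (K / b ^ 3 * X 1 s + K / b * X 2 s))
      = 4 * (K * b / ε) * (X 1 s + b ^ 2 * X 2 s) := by
    field_simp
  have h5 : K * b / ε ≤ ε / 18 := by
    rw [div_le_iff₀ hε]
    linarith
  have h6 := mul_le_mul_of_nonneg_right h5 (by positivity : 0 ≤ X 1 s + b ^ 2 * X 2 s)
  linarith

lemma third_rate_le (H : EnergyBalance ε (b ^ 2) X Y r Z Q q) (hε : 0 < ε) (hb : 0 < b)
    (hE : ∀ t > 0, X 0 t + b ^ 2 * X 1 t + (b ^ 2) ^ 2 * X 2 t ≤ K) (hK : 18 * K * b ≤ ε ^ 2)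
    {t : ℝ} (ht : 0 < t) :
    q t + b ^ 2 * ε ^ 2 * r 2 t + ε ^ 2 / 2 * (r 1 t + b ^ 2 * r 2 t + (b ^ 2) ^ 2 * r 3 t)
      + 2 * (b ^ 2 * (r 1 t + b ^ 2 * r 2 t + (b ^ 2) ^ 2 * r 3 t)
      + 1 / 9 * (r 0 t + b ^ 2 * r 1 t + (b ^ 2) ^ 2 * r 2 t)) ≤ -(ε ^ 3 / 2 * X 2 t) := by
  have x2 := H.posX 2 t
  have y1 := H.posY 1 t
  have y3 := H.posY 3 t
  have z := mul_nonneg hε.le (H.posZ t)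
  have h0 := H.first_rate_le hε hb hE hK ht
  have h1 := mul_le_mul_of_nonneg_left (H.first t ht) (by positivity : 0 ≤ ε ^ 2 / 2)
  have h2 : ε ^ 2 / 2 * (-ε * X 2 t + 4 / ε * Z t) = -(ε ^ 3 / 2 * X 2 t) + 2 * (ε * Z t) := by
    field_simp
    ring
  have h3 : 18 * (b⁻¹ * X 0 t + b⁻¹⁻¹ * X 1 t) / ε
        * ((b ^ 2) ^ 2 * X 2 t + (b ^ 2) ^ 2 * Y 1 t + (b ^ 2) ^ 4 * Y 3 t)
      ≤ 18 * (K / b) / ε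
        * ((b ^ 2) ^ 2 * X 2 t + (b ^ 2) ^ 2 * Y 1 t + (b ^ 2) ^ 4 * Y 3 t) := by
    gcongr
    exact H.sup_le hb (hE t ht)
  have h4 : 18 * (K / b) / ε
        * ((b ^ 2) ^ 2 * X 2 t + (b ^ 2) ^ 2 * Y 1 t + (b ^ 2) ^ 4 * Y 3 t)
      = 18 * K * b / ε * (b ^ 2 * X 2 t + b ^ 2 * Y 1 t + (b ^ 2) ^ 3 * Y 3 t) := by
    field_simp
  have h5 : 18 * K * b / ε ≤ ε := by
    rw [div_le_iff₀ hε]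
    linarith
  have h6 := mul_le_mul_of_nonneg_right h5
    (by positivity : 0 ≤ b ^ 2 * X 2 t + b ^ 2 * Y 1 t + (b ^ 2) ^ 3 * Y 3 t)
  have h7 : 0 ≤ ε * (b ^ 2 * Y 1 t) := by positivity
  linarith [H.fourth t ht b⁻¹ (by positivity), H.parabolic t ht]

lemma hasRate_third (H : EnergyBalance ε (b ^ 2) X Y r Z Q q) : HasRate
    (fun t => Q t + b ^ 2 * ε ^ 2 * X 2 t
      + ε ^ 2 / 2 * (X 1 t + b ^ 2 * X 2 t + (b ^ 2) ^ 2 * X 3 t)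
      + 2 * (b ^ 2 * (X 1 t + b ^ 2 * X 2 t + (b ^ 2) ^ 2 * X 3 t)
      + 1 / 9 * (X 0 t + b ^ 2 * X 1 t + (b ^ 2) ^ 2 * X 2 t)))
    (fun t => q t + b ^ 2 * ε ^ 2 * r 2 t
      + ε ^ 2 / 2 * (r 1 t + b ^ 2 * r 2 t + (b ^ 2) ^ 2 * r 3 t)
      + 2 * (b ^ 2 * (r 1 t + b ^ 2 * r 2 t + (b ^ 2) ^ 2 * r 3 t)
      + 1 / 9 * (r 0 t + b ^ 2 * r 1 t + (b ^ 2) ^ 2 * r 2 t))) := by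
  have e0 := ((H.rate 0 (by omega)).add ((H.rate 1 (by omega)).smul (b ^ 2))).add
    ((H.rate 2 (by omega)).smul ((b ^ 2) ^ 2))
  have e1 := ((H.rate 1 (by omega)).add ((H.rate 2 (by omega)).smul (b ^ 2))).add
    ((H.rate 3 (by omega)).smul ((b ^ 2) ^ 2))
  exact ((H.rateQ.add ((H.rate 2 (by omega)).smul _)).add (e1.smul _)).add
    (((e1.smul _).add (e0.smul _)).smul _)

lemma third_le (H : EnergyBalance ε (b ^ 2) X Y r Z Q q) (hε : 0 < ε) (hb : 0 < b)
    (hE : ∀ t > 0, X 0 t + b ^ 2 * X 1 t + (b ^ 2) ^ 2 * X 2 t ≤ K) (hK : 18 * K * b ≤ ε ^ 2)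
    {t : ℝ} (ht : 0 < t) :
    Q t + b ^ 2 * ε ^ 2 * X 2 t
      + ε ^ 2 / 2 * (X 1 t + b ^ 2 * X 2 t + (b ^ 2) ^ 2 * X 3 t)
      + 2 * (b ^ 2 * (X 1 t + b ^ 2 * X 2 t + (b ^ 2) ^ 2 * X 3 t)
      + 1 / 9 * (X 0 t + b ^ 2 * X 1 t + (b ^ 2) ^ 2 * X 2 t))
      ≤ Q 0 + b ^ 2 * ε ^ 2 * X 2 0
      + ε ^ 2 / 2 * (X 1 0 + b ^ 2 * X 2 0 + (b ^ 2) ^ 2 * X 3 0)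
      + 2 * (b ^ 2 * (X 1 0 + b ^ 2 * X 2 0 + (b ^ 2) ^ 2 * X 3 0)
      + 1 / 9 * (X 0 0 + b ^ 2 * X 1 0 + (b ^ 2) ^ 2 * X 2 0)) :=
  H.hasRate_third.le_initial (fun s hs => (H.third_rate_le hε hb hE hK hs).trans (by
    have := H.posX 2 s
    have : 0 ≤ ε ^ 3 / 2 * X 2 s := by positivity
    linarith)) ht

/-- Bound on `βε‖∂ₓ²u‖²` for `ε ≤ 1`, given a bound `P` on `‖u‖² + ε²‖∂ₓu‖²`. -/
lemma fourth_le (H : EnergyBalance ε (b ^ 2) X Y r Z Q q) (hε : 0 < ε) (hb : 0 < b)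
    (hE : ∀ t > 0, X 0 t + b ^ 2 * X 1 t + (b ^ 2) ^ 2 * X 2 t ≤ K) (hK : 18 * K * b ≤ ε ^ 2)
    {P D : ℝ} (hε1 : ε ≤ 1) (hP0 : 0 ≤ P)
    (hP : ∀ t > 0, X 0 t + ε ^ 2 * X 1 t ≤ P) (hD : b ^ 2 ≤ D ^ 2 * ε ^ 4) {t : ℝ} (ht : 0 < t) :
    b ^ 2 * ε * X 2 t ≤ b ^ 2 * ε * X 2 0 + D ^ 2 * (80 * P + 1) * (Q 0 + b ^ 2 * ε ^ 2 * X 2 0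
      + ε ^ 2 / 2 * (X 1 0 + b ^ 2 * X 2 0 + (b ^ 2) ^ 2 * X 3 0)
      + 2 * (b ^ 2 * (X 1 0 + b ^ 2 * X 2 0 + (b ^ 2) ^ 2 * X 3 0)
      + 1 / 9 * (X 0 0 + b ^ 2 * X 1 0 + (b ^ 2) ^ 2 * X 2 0))) := by
  have h := (((H.rate 2 (by omega)).smul (b ^ 2 * ε)).add
    (H.hasRate_third.smul (D ^ 2 * (80 * P + 1)))).le_initial (fun s hs => by
      have x2 := H.posX 2 s
      have h3 := mul_le_mul_of_nonneg_left (H.third_rate_le hε hb hE hK hs)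
        (by positivity : 0 ≤ D ^ 2 * (80 * P + 1))
      have h4 := H.parabolic' s hs ε⁻¹ (by positivity)
      have h5 : ε⁻¹ * X 0 s + ε⁻¹⁻¹ * X 1 s = (X 0 s + ε ^ 2 * X 1 s) / ε := by
        field_simp
      have h6 : (X 0 s + ε ^ 2 * X 1 s) / ε ≤ P / ε := by
        gcongr
        exact hP s hs
      have h7 : b ^ 2 * (P / ε) ≤ D ^ 2 * ε ^ 4 * (P / ε) := by gcongr
      have h8 : D ^ 2 * ε ^ 4 * (P / ε) = D ^ 2 * P * ε ^ 3 := by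
        field_simp
      have h9 : b ^ 2 ≤ D ^ 2 * ε ^ 3 := hD.trans
        (mul_le_mul_of_nonneg_left (pow_le_pow_of_le_one hε.le hε1 (by norm_num)) (sq_nonneg D))
      have h10 : (40 * b ^ 2 * (ε⁻¹ * X 0 s + ε⁻¹⁻¹ * X 1 s) + b ^ 2 / 2) * X 2 s
          ≤ (D ^ 2 * (80 * P + 1) * (ε ^ 3 / 2)) * X 2 s := by
        refine mul_le_mul_of_nonneg_right ?_ x2
        rw [h5]
        have := mul_le_mul_of_nonneg_left h6 (by positivity : 0 ≤ b ^ 2)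
        linarith
      linarith) ht
  have x0 := H.posX 0 t
  have x1 := H.posX 1 t
  have x2 := H.posX 2 t
  have x3 := H.posX 3 t
  have hQ := H.posQ t
  have hpos : 0 ≤ D ^ 2 * (80 * P + 1) * (Q t + b ^ 2 * ε ^ 2 * X 2 t
      + ε ^ 2 / 2 * (X 1 t + b ^ 2 * X 2 t + (b ^ 2) ^ 2 * X 3 t)
      + 2 * (b ^ 2 * (X 1 t + b ^ 2 * X 2 t + (b ^ 2) ^ 2 * X 3 t)
      + 1 / 9 * (X 0 t + b ^ 2 * X 1 t + (b ^ 2) ^ 2 * X 2 t))) := by positivity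
  linarith

end EnergyBalance

lemma mul_nL2_le {c M : ℝ} {f : ℝ → ℝ} (hc : 0 ≤ c) (h : c ^ 2 * (∫ x, f x ^ 2) ≤ M) :
    c * nL2 f ≤ √M := by
  calc c * nL2 f = √(c ^ 2 * ∫ x, f x ^ 2) := by
        rw [Real.sqrt_mul (sq_nonneg c), Real.sqrt_sq hc, nL2]
    _ ≤ √M := Real.sqrt_le_sqrt h

/-- Uniform-in-time bounds for the Rosenau–KdV–RLW approximation (★). -/
theorem uniform_bounds_KdVRLW (C0 : ℝ) (hC0 : 0 < C0) :
    ∃ D : ℝ, 0 < D ∧ ∃ C : ℝ, 0 < C ∧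
      ∀ ε β : ℝ, 0 < ε → 0 < β → β ≤ D ^ 2 * ε ^ 4 →
        ∀ u : ℝ → ℝ → ℝ, IsAdmissibleKdVRLW ε β u →
          DataBoundsKdVRLW ε β C0 (u 0) →
          ∀ t > (0 : ℝ),
            ε * nL2 (fun x => mixedD u 0 1 t x) ≤ C ∧
            Real.sqrt (β * ε) * nL2 (fun x => mixedD u 0 2 t x) ≤ C ∧
            ε * Real.sqrt β * nL2 (fun x => mixedD u 0 2 t x) ≤ C ∧
            β * nL2 (fun x => mixedD u 0 2 t x) ≤ C ∧
            β * ε * nL2 (fun x => mixedD u 0 3 t x) ≤ C ∧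
            β ^ ((3 : ℝ) / 2) * nL2 (fun x => mixedD u 0 3 t x) ≤ C ∧
            β ^ 2 * nL2 (fun x => mixedD u 0 4 t x) ≤ C := by

  set M := 11 * C0 + (1 / (36 * C0)) ^ 2 * (80 * (12 * C0) + 1) * (5 * C0) with hM
  have hM' : 0 ≤ (1 / (36 * C0)) ^ 2 * (80 * (12 * C0) + 1) * (5 * C0) := by positivity
  refine ⟨1 / (36 * C0), by positivity, √M, Real.sqrt_pos.2 (by linarith), ?_⟩
  intro ε β hε hβ hD u hu ⟨d0, d1, d2⟩ t ht
  obtain ⟨b, hb, rfl⟩ : ∃ b : ℝ, 0 < b ∧ b ^ 2 = β := ⟨√β, Real.sqrt_pos.2 hβ, Real.sq_sqrt hβ.le⟩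
  have H := hu.evolution.energyBalance hε hβ
  have e0 : ∀ x, u 0 x = mixedD u 0 0 0 x := fun x => by simp [mixedD]
  have e1 : ∀ x, deriv (u 0) x = mixedD u 0 1 0 x := fun x => by simp [mixedD]
  have e : ∀ k x, iteratedDeriv k (u 0) x = mixedD u 0 k 0 x := fun k x => by simp [mixedD]
  simp only [e0, e1, e] at d0 d1 d2
  suffices hs : ε ^ 2 * (∫ x, mixedD u 0 1 t x ^ 2) ≤ M ∧
      b ^ 2 * ε * (∫ x, mixedD u 0 2 t x ^ 2) ≤ M ∧
      ε ^ 2 * b ^ 2 * (∫ x, mixedD u 0 2 t x ^ 2) ≤ M ∧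
      (b ^ 2) ^ 2 * (∫ x, mixedD u 0 2 t x ^ 2) ≤ M ∧
      (b ^ 2 * ε) ^ 2 * (∫ x, mixedD u 0 3 t x ^ 2) ≤ M ∧
      (b ^ 2) ^ 3 * (∫ x, mixedD u 0 3 t x ^ 2) ≤ M ∧
      ((b ^ 2) ^ 2) ^ 2 * (∫ x, mixedD u 0 4 t x ^ 2) ≤ M by
    obtain ⟨h1, h2, h3, h4, h5, h6, h7⟩ := hs
    refine ⟨mul_nL2_le hε.le h1, mul_nL2_le (by positivity) ?_, mul_nL2_le (by positivity) ?_,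
      mul_nL2_le (by positivity) h4, mul_nL2_le (by positivity) h5, mul_nL2_le (by positivity) ?_,
      mul_nL2_le (by positivity) h7⟩
    · rwa [Real.sq_sqrt (by positivity)]
    · rwa [mul_pow, Real.sq_sqrt (by positivity)]
    · rw [← Real.rpow_natCast, ← Real.rpow_mul (by positivity)]
      norm_num at h6 ⊢
      exact h6
  have hbε : 36 * C0 * b ≤ ε ^ 2 := by
    have : b ≤ 1 / (36 * C0) * ε ^ 2 := by
      refine le_of_sq_le_sq (hD.trans_eq (by ring)) (by positivity)
    calc 36 * C0 * b ≤ 36 * C0 * (1 / (36 * C0) * ε ^ 2) := by gcongr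
      _ = ε ^ 2 := by field_simp
  generalize (fun k t => 2 * ∫ x, mixedD u 0 k t x * mixedD u 1 k t x) = r at H
  generalize hX : (fun k t => ∫ x, mixedD u 0 k t x ^ 2) = X at H
  generalize (fun k t => ∫ x, mixedD u 1 k t x ^ 2) = Y at H
  generalize (fun t => ∫ x, (mixedD u 0 0 t x * mixedD u 0 1 t x) ^ 2) = Z at H
  generalize hQ : (fun t => ∫ x, mixedD u 0 0 t x ^ 4) = Q at H
  have eX : ∀ k t, (∫ x, mixedD u 0 k t x ^ 2) = X k t := fun k t => congrFun (congrFun hX k) t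
  have eQ : (∫ x, mixedD u 0 0 0 x ^ 4) = Q 0 := congrFun hQ 0
  simp only [eX, eQ] at d0 d1 d2 ⊢
  clear hX hQ eX eQ e e0 e1
  have bε := mul_pos (pow_pos hb 2) hε
  have pX : ∀ c : ℝ, 0 ≤ c → ∀ k s, 0 ≤ c * X k s := fun c hc k s => mul_nonneg hc (H.posX k s)
  have hb2 := sq_nonneg b
  have hε2 := sq_nonneg ε
  have p0 := H.posX 0
  have pQ := H.posQ
  have p1 := pX _ hb2 1
  have p1' := pX _ hε2 1
  have p2 := pX ((b ^ 2) ^ 2) (by positivity) 2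
  have p2' := pX (b ^ 2 * ε) (by positivity) 2
  have p2'' := pX (b ^ 2 * ε ^ 2) (by positivity) 2
  have p3 := pX ((b ^ 2) ^ 3) (by positivity) 3
  have p3' := pX ((b ^ 2) ^ 2 * ε ^ 2) (by positivity) 3
  have p4 := pX ((b ^ 2) ^ 4) (by positivity) 4
  have hE : ∀ s > 0, X 0 s + b ^ 2 * X 1 s + (b ^ 2) ^ 2 * X 2 s ≤ 2 * C0 := fun s hs =>
    (H.energy_le hε hs).trans (by
      linarith only [d0, d1, pQ 0, p1' 0, p2' 0, p2'' 0, p3 0, p3' 0])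
  have hK : 18 * (2 * C0) * b ≤ ε ^ 2 := by linarith
  have first := H.first_le hε hb hE hK ht
  have second := H.second_le hε hb hE hK ht
  have data : Q 0 + b ^ 2 * ε ^ 2 * X 2 0
      + ε ^ 2 / 2 * (X 1 0 + b ^ 2 * X 2 0 + (b ^ 2) ^ 2 * X 3 0)
      + 2 * (b ^ 2 * (X 1 0 + b ^ 2 * X 2 0 + (b ^ 2) ^ 2 * X 3 0)
      + 1 / 9 * (X 0 0 + b ^ 2 * X 1 0 + (b ^ 2) ^ 2 * X 2 0)) ≤ 5 * C0 := by
    linarith only [hC0, d0, d1, p0 0, pQ 0, p1 0, p1' 0, p2 0, p2' 0, p2'' 0, p3 0, p3' 0]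
  have third : ∀ s > 0, ε ^ 2 * X 1 s + b ^ 2 * ε ^ 2 * X 2 s + (b ^ 2) ^ 2 * ε ^ 2 * X 3 s
      ≤ 10 * C0 := fun s hs => by
    linarith only [H.third_le hε hb hE hK hs, data, p0 s, pQ s, p1 s, p2 s, p2'' s, p3 s]
  have h3 := third t ht
  refine ⟨?_, ?_, ?_, ?_, ?_, ?_, ?_⟩
  · linarith only [hM, hM', hC0, h3, p2'' t, p3' t]
  · rcases le_total ε 1 with h1 | h1
    · have h4 := H.fourth_le hε hb hE hK (P := 12 * C0) h1 (by positivity) (fun s hs => by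
        linarith only [hE s hs, third s hs, p1 s, p2 s, p2'' s, p3' s]) hD ht
      have h5 := mul_le_mul_of_nonneg_left data
        (by positivity : 0 ≤ (1 / (36 * C0)) ^ 2 * (80 * (12 * C0) + 1))
      linarith only [hM, hC0, h4, h5, d1, p2 0, p2'' 0, p3 0, p3' 0]
    · have h4 := mul_le_mul_of_nonneg_left h1 (p2' t)
      linarith only [hM, hM', hC0, h3, h4, p1' t, p3' t]
  · linarith only [hM, hM', hC0, h3, p1' t, p3' t]
  · linarith only [hM, hM', hC0, hE t ht, p0 t, p1 t]
  · linarith only [hM, hM', hC0, h3, p1' t, p2'' t]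
  · linarith only [hM, hM', hC0, first, d0, d1, p0 0, pQ 0, p1 0, p1' 0, p2 0, p2' 0, p2'' 0,
      p3 0, p3' 0, p0 t, p1 t, p2 t]
  · linarith only [hM, hM', hC0, second, d0, d1, d2, p0 0, pQ 0, p1 0, p1' 0, p2 0, p2' 0, p2'' 0,
      p3 0, p3' 0, p0 t, p1 t, p2 t, p3 t]

end
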